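/- arXiv:0704.2600 — 2 statements merged into one kernel-verified Lean document; each statement's English description precedes it below -/
import Mathlib

section
/- Let x ∈ B_n be a left rigid braid with ℓ(x) > 1. The map Φ : USS_L(x) → USS_R(x), defined by Φ(y) = c_R^{2rt}(y) for any t ≥ 0 with c_R^{2rt}(y) right rigid (where r = ℓ(x)), is bijective. In particular #USS_L(x) = #USS_R(x). -/
/-!
Axiomatization of Garside groups (positive cone, Garside element, lattice
structure, left/right normal forms), following the paper
"On the cycling operation in braid groups" by Gebhardt and González-Meneses.
-/

namespace Garside

variable {G : Type*} [Group G]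

/-- `a ≼ b`: `a` is a left divisor (prefix) of `b` w.r.t. the positive cone `P`. -/
def LeftDvd (P : Submonoid G) (a b : G) : Prop := a⁻¹ * b ∈ P

/-- `a` is a right divisor (suffix) of `b` w.r.t. the positive cone `P`
(i.e. `b ≽ a` in the notation of the paper). -/
def RightDvd (P : Submonoid G) (a b : G) : Prop := b * a⁻¹ ∈ P

/-- A simple element: a positive prefix of `Δ`. -/
def Simple (P : Submonoid G) (Δ : G) (s : G) : Prop := s ∈ P ∧ LeftDvd P s Δ

/-- An atom: a nontrivial positive element which is not the product
of two nontrivial positive elements. -/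
def Atom (P : Submonoid G) (a : G) : Prop :=
  a ∈ P ∧ a ≠ 1 ∧ ∀ b c : G, b ∈ P → c ∈ P → a = b * c → b = 1 ∨ c = 1

/-- `Δ^p x₁ ⋯ x_r` (with `l = [x₁,…,x_r]`) is the left normal form of `x`:
each factor is a proper simple element and consecutive factors are
left-weighted, `x_i = (x_i x_{i+1}) ∧_L Δ`. -/
def IsLeftNF (P : Submonoid G) (Δ : G) (gcdL : G → G → G) (p : ℤ) (l : List G) (x : G) :
    Prop :=
  x = Δ ^ p * l.prod ∧ (∀ s ∈ l, Simple P Δ s ∧ s ≠ 1 ∧ s ≠ Δ) ∧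
    l.Chain' (fun s t => gcdL (s * t) Δ = s)

/-- `y₁ ⋯ y_r Δ^p` (with `l = [y₁,…,y_r]`) is the right normal form of `x`:
each factor is a proper simple element and consecutive factors are
right-weighted, `y_{i+1} = (y_i y_{i+1}) ∧_R Δ`. -/
def IsRightNF (P : Submonoid G) (Δ : G) (gcdR : G → G → G) (p : ℤ) (l : List G) (x : G) :
    Prop :=
  x = l.prod * Δ ^ p ∧ (∀ s ∈ l, Simple P Δ s ∧ s ≠ 1 ∧ s ≠ Δ) ∧
    l.Chain' (fun s t => gcdR (s * t) Δ = t)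

/-- A Garside structure on a group `G`: a positive cone which induces lattice
orders by left and right divisibility, and a Garside element `Δ` whose left and
right divisors coincide (the simple elements), generate the group, and such that
every element admits a unique left and right normal form. -/
structure GarsideGroup (G : Type*) [Group G] where
  pos : Submonoid G
  pos_antisymm : ∀ a : G, a ∈ pos → a⁻¹ ∈ pos → a = 1
  Δ : G
  Δ_pos : Δ ∈ pos
  gcdL : G → G → G
  gcdL_dvd_left : ∀ a b : G, LeftDvd pos (gcdL a b) a
  gcdL_dvd_right : ∀ a b : G, LeftDvd pos (gcdL a b) b
  dvd_gcdL : ∀ a b c : G, LeftDvd pos c a → LeftDvd pos c b → LeftDvd pos c (gcdL a b)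
  lcmL : G → G → G
  dvd_lcmL_left : ∀ a b : G, LeftDvd pos a (lcmL a b)
  dvd_lcmL_right : ∀ a b : G, LeftDvd pos b (lcmL a b)
  lcmL_dvd : ∀ a b c : G, LeftDvd pos a c → LeftDvd pos b c → LeftDvd pos (lcmL a b) c
  gcdR : G → G → G
  gcdR_dvd_left : ∀ a b : G, RightDvd pos (gcdR a b) a
  gcdR_dvd_right : ∀ a b : G, RightDvd pos (gcdR a b) b
  dvd_gcdR : ∀ a b c : G, RightDvd pos c a → RightDvd pos c b → RightDvd pos c (gcdR a b)
  lcmR : G → G → G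
  dvd_lcmR_left : ∀ a b : G, RightDvd pos a (lcmR a b)
  dvd_lcmR_right : ∀ a b : G, RightDvd pos b (lcmR a b)
  lcmR_dvd : ∀ a b c : G, RightDvd pos a c → RightDvd pos b c → RightDvd pos (lcmR a b) c
  divisors_Δ : ∀ s : G, (s ∈ pos ∧ LeftDvd pos s Δ) ↔ (s ∈ pos ∧ RightDvd pos s Δ)
  simples_generate : Subgroup.closure {s : G | Simple pos Δ s} = ⊤
  lnf_exists : ∀ x : G, ∃ pl : ℤ × List G, IsLeftNF pos Δ gcdL pl.1 pl.2 x
  lnf_unique : ∀ (x : G) (p q : ℤ) (l m : List G),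
    IsLeftNF pos Δ gcdL p l x → IsLeftNF pos Δ gcdL q m x → p = q ∧ l = m
  rnf_exists : ∀ x : G, ∃ pl : ℤ × List G, IsRightNF pos Δ gcdR pl.1 pl.2 x
  rnf_unique : ∀ (x : G) (p q : ℤ) (l m : List G),
    IsRightNF pos Δ gcdR p l x → IsRightNF pos Δ gcdR q m x → p = q ∧ l = m
  lnf_rnf_agree : ∀ (x : G) (p q : ℤ) (l m : List G),
    IsLeftNF pos Δ gcdL p l x → IsRightNF pos Δ gcdR q m x → p = q ∧ l.length = m.length

/-- `L` is the left lcm of the set `S`. -/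
def IsLcmL (P : Submonoid G) (S : Set G) (L : G) : Prop :=
  (∀ a ∈ S, LeftDvd P a L) ∧ ∀ c : G, (∀ a ∈ S, LeftDvd P a c) → LeftDvd P L c

/-- A Garside group is atom-friendly (on the left) if `Δ` is the left lcm of the
set of atoms and the starting set of the left lcm of any set `B` of atoms is `B`. -/
def AtomFriendlyL (𝒢 : GarsideGroup G) : Prop :=
  IsLcmL 𝒢.pos {a : G | Atom 𝒢.pos a} 𝒢.Δ ∧
    ∀ B : Set G, B ⊆ {a : G | Atom 𝒢.pos a} →
      ∃ L : G, IsLcmL 𝒢.pos B L ∧ {a : G | Atom 𝒢.pos a ∧ LeftDvd 𝒢.pos a L} = B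

namespace GarsideGroup

variable (𝒢 : GarsideGroup G)

/-- The left normal form of `x`, as a pair (infimum, list of factors). -/
noncomputable def lnf (x : G) : ℤ × List G := Classical.choose (𝒢.lnf_exists x)

/-- The right normal form of `x`, as a pair (exponent of `Δ`, list of factors). -/
noncomputable def rnf (x : G) : ℤ × List G := Classical.choose (𝒢.rnf_exists x)

/-- `inf x = p`, the maximal `p` with `Δ^p ≼ x`. -/
noncomputable def inf (x : G) : ℤ := (𝒢.lnf x).1

/-- The canonical length `ℓ(x) = r`. -/
noncomputable def len (x : G) : ℕ := (𝒢.lnf x).2.length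

/-- `sup x = p + r`. -/
noncomputable def sup (x : G) : ℤ := 𝒢.inf x + 𝒢.len x

/-- `tau 𝒢 k x = τ^k(x) = Δ^{-k} x Δ^k`. -/
def tau (k : ℤ) (x : G) : G := 𝒢.Δ ^ (-k) * x * 𝒢.Δ ^ k

/-- The left initial factor `ι_L(x) = τ^{-p}(x₁)` (equal to `1` if `ℓ(x) = 0`). -/
noncomputable def iotaL (x : G) : G := 𝒢.tau (-(𝒢.lnf x).1) ((𝒢.lnf x).2.headD 1)

/-- The right initial factor `ι_R(x) = τ^{p}(y_r)` (equal to `1` if `ℓ(x) = 0`). -/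
noncomputable def iotaR (x : G) : G := 𝒢.tau (𝒢.rnf x).1 (((𝒢.rnf x).2.getLast?).getD 1)

/-- Left cycling: `c_L(x) = ι_L(x)⁻¹ · x · ι_L(x)`. -/
noncomputable def cL (x : G) : G := (𝒢.iotaL x)⁻¹ * x * 𝒢.iotaL x

/-- Right cycling: `c_R(x) = ι_R(x) · x · ι_R(x)⁻¹`. -/
noncomputable def cR (x : G) : G := 𝒢.iotaR x * x * (𝒢.iotaR x)⁻¹

/-- `x = Δ^p x₁⋯x_r` (in left normal form, `r > 0`) is left rigid if
`Δ^p x₁⋯x_r ι_L(x)` is in left normal form as written. -/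
def LeftRigid (x : G) : Prop :=
  (𝒢.lnf x).2 ≠ [] ∧
    IsLeftNF 𝒢.pos 𝒢.Δ 𝒢.gcdL (𝒢.lnf x).1 ((𝒢.lnf x).2 ++ [𝒢.iotaL x]) (x * 𝒢.iotaL x)

/-- `x = y₁⋯y_r Δ^p` (in right normal form, `r > 0`) is right rigid if
`ι_R(x) y₁⋯y_r Δ^p` is in right normal form as written. -/
def RightRigid (x : G) : Prop :=
  (𝒢.rnf x).2 ≠ [] ∧
    IsRightNF 𝒢.pos 𝒢.Δ 𝒢.gcdR (𝒢.rnf x).1 (𝒢.iotaR x :: (𝒢.rnf x).2) (𝒢.iotaR x * x)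

/-- The super summit set: conjugates of minimal canonical length. -/
def SSS (x : G) : Set G :=
  {y | IsConj x y ∧ ∀ z : G, IsConj x z → 𝒢.len y ≤ 𝒢.len z}

/-- The left ultra summit set. -/
def USSL (x : G) : Set G :=
  {y ∈ 𝒢.SSS x | ∃ t : ℕ, 1 ≤ t ∧ (𝒢.cL)^[t] y = y}

/-- The right ultra summit set. -/
def USSR (x : G) : Set G :=
  {y ∈ 𝒢.SSS x | ∃ t : ℕ, 1 ≤ t ∧ (𝒢.cR)^[t] y = y}

/-- `x` is periodically geodesic: `inf(x^m) = m inf(x)` and `sup(x^m) = m sup(x)`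
for all `m ≥ 1`. -/
def PeriodicallyGeodesic (x : G) : Prop :=
  ∀ m : ℕ, 1 ≤ m → 𝒢.inf (x ^ m) = (m : ℤ) * 𝒢.inf x ∧ 𝒢.sup (x ^ m) = (m : ℤ) * 𝒢.sup x

/-- The left interior `x°_L = x Δ^{-p}`, where `p = inf(x)`. -/
noncomputable def intL (x : G) : G := x * 𝒢.Δ ^ (-𝒢.inf x)

/-- The right interior `x°_R = Δ^{-p} x`, where `p = inf(x)`. -/
noncomputable def intR (x : G) : G := 𝒢.Δ ^ (-𝒢.inf x) * x

/-- The right transport of `v` (where `v x v⁻¹ = z`):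
`v^{(1)}_R = ι_R(z) · v · ι_R(x)⁻¹`. -/
noncomputable def transR (x v : G) : G := 𝒢.iotaR (v * x * v⁻¹) * v * (𝒢.iotaR x)⁻¹

/-- The iterated right transport `v^{(i)}_R` of `v` along the right cyclings of `x`. -/
noncomputable def transRIter (x : G) : ℕ → G → G
  | 0, v => v
  | i + 1, v => 𝒢.transR ((𝒢.cR)^[i] x) (transRIter x i v)

/-- Arrows of the left ultra summit graph `USG_L(x)`: triples `(u, s, v)` with
`u, v ∈ USS_L(x)`, `s` simple and `s⁻¹ u s = v`. -/
def ArrL (x : G) : Set (G × G × G) :=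
  {a | a.1 ∈ 𝒢.USSL x ∧ a.2.2 ∈ 𝒢.USSL x ∧ Simple 𝒢.pos 𝒢.Δ a.2.1 ∧
    a.2.1⁻¹ * a.1 * a.2.1 = a.2.2}

/-- Arrows of the right ultra summit graph `USG_R(x)`: triples `(u, s, v)` with
`u, v ∈ USS_R(x)`, `s` simple and `s u s⁻¹ = v`. -/
def ArrR (x : G) : Set (G × G × G) :=
  {a | a.1 ∈ 𝒢.USSR x ∧ a.2.2 ∈ 𝒢.USSR x ∧ Simple 𝒢.pos 𝒢.Δ a.2.1 ∧
    a.2.1 * a.1 * a.2.1⁻¹ = a.2.2}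

/-- `PathFrom A u l`: the list of arrows `l` forms a directed path in the
graph with arrow set `A`, starting at the vertex `u`. -/
def PathFrom (A : Set (G × G × G)) : G → List (G × G × G) → Prop
  | _, [] => True
  | u, a :: rest => a ∈ A ∧ a.1 = u ∧ PathFrom A a.2.2 rest

/-- Minimal arrows of `USG_L(x)`: arrows whose label is not a product of the
labels of a directed path of length at least 2 starting at the same vertex. -/
def MinArrL (x : G) : Set (G × G × G) :=
  {a | a ∈ 𝒢.ArrL x ∧ ¬ ∃ l : List (G × G × G), 2 ≤ l.length ∧
    PathFrom (𝒢.ArrL x) a.1 l ∧ (l.map (fun b => b.2.1)).prod = a.2.1}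

/-- Minimal arrows of `USG_R(x)`. -/
def MinArrR (x : G) : Set (G × G × G) :=
  {a | a ∈ 𝒢.ArrR x ∧ ¬ ∃ l : List (G × G × G), 2 ≤ l.length ∧
    PathFrom (𝒢.ArrR x) a.1 l ∧ (l.map (fun b => b.2.1)).prod = a.2.1}

end GarsideGroup

end Garside

namespace Garside

/-- The braid relations on `m` generators `σ₀, …, σ_{m-1}`:
`σᵢσⱼ = σⱼσᵢ` for `|i-j| > 1` and `σᵢσⱼσᵢ = σⱼσᵢσⱼ` for `|i-j| = 1`. -/
def braidRels (m : ℕ) : Set (FreeGroup (Fin m)) :=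
  {r | (∃ i j : Fin m, (i : ℕ) + 1 < (j : ℕ) ∧
          r = FreeGroup.of i * FreeGroup.of j * (FreeGroup.of i)⁻¹ * (FreeGroup.of j)⁻¹) ∨
       (∃ i j : Fin m, (i : ℕ) + 1 = (j : ℕ) ∧
          r = FreeGroup.of i * FreeGroup.of j * FreeGroup.of i *
              (FreeGroup.of j * FreeGroup.of i * FreeGroup.of j)⁻¹)}

/-- Artin's braid group on `n` strands, presented by the `n-1` generators
`σ₁, …, σ_{n-1}` and the braid relations. -/
abbrev BraidGroup (n : ℕ) := PresentedGroup (braidRels (n - 1))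

/-- The Artin generators of the braid group. -/
def σB (n : ℕ) (i : Fin (n - 1)) : BraidGroup n :=
  PresentedGroup.of (rels := braidRels (n - 1)) i

/-- The half twist `Δ = σ₁ (σ₂σ₁) ⋯ (σ_{n-1} ⋯ σ₁)`, the Garside element of `Bₙ`. -/
def halfTwist (n : ℕ) : BraidGroup n :=
  ((List.finRange (n - 1)).map fun k =>
    ((((List.finRange (n - 1)).filter fun j => decide (j ≤ k)).reverse.map (σB n)).prod)).prod

/-- `𝒢` is the (left and right) Garside structure of the braid group `Bₙ`:
the positive cone is the monoid of positive braids, generated by the Artin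
generators, and the Garside element is the half twist `Δ`. -/
def IsBraidGarside (n : ℕ) (𝒢 : GarsideGroup (BraidGroup n)) : Prop :=
  𝒢.pos = Submonoid.closure (Set.range (σB n)) ∧ 𝒢.Δ = halfTwist n

end Garside


set_option linter.unusedSectionVars false

namespace Garside

/-- One-sided data used in the proof: a left lattice order, a Garside element, and an additive
length function. -/
structure LS {G : Type*} [Group G] (P : Submonoid G) (Δ : G) (gcd lcm : G → G → G)
    (lam : G → ℤ) : Prop where
  antisymm : ∀ a : G, a ∈ P → a⁻¹ ∈ P → a = 1
  Δ_pos : Δ ∈ P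
  gcd_left : ∀ a b : G, LeftDvd P (gcd a b) a
  gcd_right : ∀ a b : G, LeftDvd P (gcd a b) b
  dvd_gcd : ∀ a b c : G, LeftDvd P c a → LeftDvd P c b → LeftDvd P c (gcd a b)
  left_lcm : ∀ a b : G, LeftDvd P a (lcm a b)
  right_lcm : ∀ a b : G, LeftDvd P b (lcm a b)
  lcm_dvd : ∀ a b c : G, LeftDvd P a c → LeftDvd P b c → LeftDvd P (lcm a b) c
  conj : ∀ a ∈ P, Δ * a * Δ⁻¹ ∈ P
  cent : ∀ g : G, Δ ^ 2 * g = g * Δ ^ 2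
  lam_mul : ∀ a b : G, lam (a * b) = lam a + lam b
  lam_nonneg : ∀ a ∈ P, 0 ≤ lam a
  lam_zero : ∀ a ∈ P, lam a = 0 → a = 1
  bdd : ∀ g : G, ∃ k : ℕ, Δ ^ k * g ∈ P

/-- `y^M Δ^{-Mp}`. -/
def YY {G : Type*} [Group G] (Δ : G) (p : ℤ) (y : G) (M : ℕ) : G :=
  y ^ M * Δ ^ (-((M : ℤ) * p))

/-- Rigidity in terms of the order. -/
def LR {G : Type*} [Group G] (P : Submonoid G) (Δ : G) (p : ℤ) (r : ℕ) (y : G) : Prop :=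
  LeftDvd P (Δ ^ p) y ∧ LeftDvd P y (Δ ^ (p + r)) ∧
    ∀ (M t : ℕ) (d : G), LeftDvd P d (YY Δ p y M) → LeftDvd P d (Δ ^ ((r : ℤ) * t)) →
      LeftDvd P d (YY Δ p y t)

/-- The set of `V` below `y^∞` with `y^t V Δ^{-tp} ≼ Δ^{rt}` for some `t`. -/
def AA {G : Type*} [Group G] (P : Submonoid G) (Δ : G) (p : ℤ) (r : ℕ) (y V : G) : Prop :=
  (∃ M : ℕ, LeftDvd P V (YY Δ p y M)) ∧
    ∃ t : ℕ, LeftDvd P (y ^ t * V * Δ ^ (-((t : ℤ) * p))) (Δ ^ ((r : ℤ) * t))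

namespace LS

variable {G : Type*} [Group G] {P : Submonoid G} {Δ : G} {gcd lcm : G → G → G} {lam : G → ℤ}

theorem rfl' (P : Submonoid G) (a : G) : LeftDvd P a a := by simp [LeftDvd, P.one_mem]

theorem tr {a b c : G} (h1 : LeftDvd P a b) (h2 : LeftDvd P b c) : LeftDvd P a c := by
  have := P.mul_mem h1 h2
  unfold LeftDvd
  rwa [show a⁻¹ * b * (b⁻¹ * c) = a⁻¹ * c by group] at this

theorem ml {a b : G} (c : G) : LeftDvd P (c * a) (c * b) ↔ LeftDvd P a b := by
  unfold LeftDvd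
  rw [show (c * a)⁻¹ * (c * b) = a⁻¹ * b by group]

theorem le_mul {a b : G} (hb : b ∈ P) : LeftDvd P a (a * b) := by
  unfold LeftDvd
  rwa [show a⁻¹ * (a * b) = b by group]

variable (h : LS P Δ gcd lcm lam)
include h

theorem asymm {a b : G} (h1 : LeftDvd P a b) (h2 : LeftDvd P b a) : a = b := by
  have := h.antisymm (a⁻¹ * b) h1 (by
    rw [show (a⁻¹ * b)⁻¹ = b⁻¹ * a by group]; exact h2)
  rw [inv_mul_eq_one] at this; exact this

theorem lam_one : lam 1 = 0 := by have := h.lam_mul 1 1; simp at this; exact this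

theorem lam_inv (a : G) : lam a⁻¹ = - lam a := by
  have := h.lam_mul a a⁻¹; simp [h.lam_one] at this; linarith

theorem lam_pow (a : G) (k : ℕ) : lam (a ^ k) = k * lam a := by
  induction k with
  | zero => simp [h.lam_one]
  | succ k ih => rw [pow_succ, h.lam_mul, ih]; push_cast; ring

theorem lam_zpow (a : G) (k : ℤ) : lam (a ^ k) = k * lam a := by
  cases k with
  | ofNat k => simpa using h.lam_pow a k
  | negSucc k => rw [zpow_negSucc, h.lam_inv, h.lam_pow]; push_cast [Int.negSucc_eq]; ring

theorem lam_le {a b : G} (hab : LeftDvd P a b) : lam a ≤ lam b := by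
  have := h.lam_nonneg _ hab
  rw [h.lam_mul, h.lam_inv] at this; linarith

theorem eq_of_lam {a b : G} (hab : LeftDvd P a b) (hl : lam b ≤ lam a) : a = b := by
  have h1 := h.lam_nonneg _ hab
  have := h.lam_zero _ hab (by rw [h.lam_mul, h.lam_inv] at h1 ⊢; linarith)
  rwa [inv_mul_eq_one] at this

theorem cent' (k : ℤ) (g : G) : Δ ^ (2 * k) * g = g * Δ ^ (2 * k) := by
  have : Commute (Δ ^ 2) g := h.cent g
  have := this.zpow_left k
  rw [zpow_mul]; exact_mod_cast this.eq

theorem conjN (k : ℕ) : ∀ a ∈ P, Δ ^ k * a * (Δ ^ k)⁻¹ ∈ P := by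
  induction k with
  | zero => simp
  | succ k ih =>
    intro a ha
    have := h.conj _ (ih a ha)
    rwa [show Δ ^ (k + 1) * a * (Δ ^ (k + 1))⁻¹ = Δ * (Δ ^ k * a * (Δ ^ k)⁻¹) * Δ⁻¹ by
      rw [pow_succ']; group]

theorem conjZ (k : ℤ) {a : G} (ha : a ∈ P) : Δ ^ k * a * Δ ^ (-k) ∈ P := by
  have h1 := h.conjN (k + 2 * |k|).toNat a ha
  have h2 : ((k + 2 * |k|).toNat : ℤ) = k + 2 * |k| := by
    apply Int.toNat_of_nonneg
    rcases abs_cases k with h | h <;> omega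
  rw [← zpow_natCast, h2, zpow_add, mul_assoc (Δ ^ k), h.cent'] at h1
  have : Δ ^ k * a * Δ ^ (-k) = Δ ^ k * (a * Δ ^ (2 * |k|)) * (Δ ^ k * Δ ^ (2 * |k|))⁻¹ := by
    group
  rwa [this]

theorem conjZ' (k : ℤ) {a : G} (ha : a ∈ P) : Δ ^ (-k) * a * Δ ^ k ∈ P := by
  simpa using h.conjZ (-k) ha

theorem mr {a b : G} (k : ℤ) : LeftDvd P (a * Δ ^ k) (b * Δ ^ k) ↔ LeftDvd P a b := by
  unfold LeftDvd
  constructor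
  · intro h1
    have := h.conjZ k h1
    rwa [show Δ ^ k * ((a * Δ ^ k)⁻¹ * (b * Δ ^ k)) * Δ ^ (-k) = a⁻¹ * b by group] at this
  · intro h1
    have := h.conjZ' k h1
    rwa [show (a * Δ ^ k)⁻¹ * (b * Δ ^ k) = Δ ^ (-k) * (a⁻¹ * b) * Δ ^ k by group]

theorem zpow_mono {a b : ℤ} (hab : a ≤ b) : LeftDvd P (Δ ^ a) (Δ ^ b) := by
  obtain ⟨k, rfl⟩ := Int.le.dest hab
  rw [zpow_add]
  exact le_mul (by rw [zpow_natCast]; exact P.pow_mem h.Δ_pos k)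

theorem zpow_mono' (g : G) {a b : ℤ} (hab : a ≤ b) : LeftDvd P (g * Δ ^ a) (g * Δ ^ b) :=
  (ml g).2 (h.zpow_mono hab)

theorem pos_zpow {a : G} (ha : a ∈ P) (k : ℤ) : LeftDvd P (Δ ^ k) (a * Δ ^ k) := by
  have : LeftDvd P 1 a := by simpa [LeftDvd] using ha
  simpa using (h.mr k).2 this

theorem dvd_gcd_iff {a b c : G} : LeftDvd P c (gcd a b) ↔ LeftDvd P c a ∧ LeftDvd P c b :=
  ⟨fun hc => ⟨tr hc (h.gcd_left a b), tr hc (h.gcd_right a b)⟩, fun hc => h.dvd_gcd _ _ _ hc.1 hc.2⟩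

/-- gcd is compatible with left multiplication and right multiplication by powers of `Δ`. -/
theorem dvd_gcd_trans {a b c d : G} (k : ℤ) :
    LeftDvd P d (c * gcd a b * Δ ^ k) ↔
      LeftDvd P d (c * a * Δ ^ k) ∧ LeftDvd P d (c * b * Δ ^ k) := by
  have key : ∀ z, LeftDvd P d (c * z * Δ ^ k) ↔ LeftDvd P (c⁻¹ * d * Δ ^ (-k)) z := by
    intro z
    rw [← h.mr k (b := z), ← ml c (b := z * Δ ^ k)]
    simp [mul_assoc]
  rw [key, key, key, h.dvd_gcd_iff]

theorem YY_zero (p : ℤ) (y : G) : YY Δ p y 0 = 1 := by simp [YY]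

theorem YY_one (p : ℤ) (y : G) : YY Δ p y 1 = y * Δ ^ (-p) := by simp [YY]

theorem YY_add (p : ℤ) (y : G) (M N : ℕ) :
    YY Δ p y (M + N) = y ^ M * YY Δ p y N * Δ ^ (-((M : ℤ) * p)) := by
  unfold YY
  rw [pow_add]
  simp only [mul_assoc, ← zpow_add]
  congr 3
  push_cast
  ring

theorem YY_succ_le {p : ℤ} {y : G} (hy : LeftDvd P (Δ ^ p) y) (M : ℕ) :
    LeftDvd P (YY Δ p y M) (YY Δ p y (M + 1)) := by
  rw [h.YY_add p y M 1, h.YY_one]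
  have : YY Δ p y M = y ^ M * 1 * Δ ^ (-((M : ℤ) * p)) := by simp [YY]
  rw [this, h.mr, ml]
  rw [← h.mr p]
  simpa using hy

theorem YY_mono {p : ℤ} {y : G} (hy : LeftDvd P (Δ ^ p) y) {M N : ℕ} (hMN : M ≤ N) :
    LeftDvd P (YY Δ p y M) (YY Δ p y N) := by
  induction N, hMN using Nat.le_induction with
  | base => exact rfl' P _
  | succ N _ ih => exact tr ih (h.YY_succ_le hy N)

theorem YY_pos {p : ℤ} {y : G} (hy : LeftDvd P (Δ ^ p) y) (M : ℕ) : YY Δ p y M ∈ P := by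
  have := h.YY_mono hy (Nat.zero_le M)
  rw [h.YY_zero] at this
  simpa [LeftDvd] using this

theorem T_succ {p : ℤ} {r : ℕ} {y V : G} (hy : LeftDvd P y (Δ ^ (p + r))) {t : ℕ}
    (ht : LeftDvd P (y ^ t * V * Δ ^ (-((t : ℤ) * p))) (Δ ^ ((r : ℤ) * t))) :
    LeftDvd P (y ^ (t + 1) * V * Δ ^ (-(((t + 1 : ℕ) : ℤ) * p))) (Δ ^ ((r : ℤ) * (t + 1 : ℕ))) := by
  have h1 : y ^ (t + 1) * V * Δ ^ (-(((t + 1 : ℕ) : ℤ) * p))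
      = (y * (y ^ t * V * Δ ^ (-((t : ℤ) * p)))) * Δ ^ (-p) := by
    rw [pow_succ']
    simp only [mul_assoc, ← zpow_add]
    push_cast
    congr 5; ring
  rw [h1]
  have h2 := (h.mr (-p)).2 ((ml y).2 ht)
  have h3 := (h.mr ((r : ℤ) * t - p)).2 hy
  rw [mul_assoc y (Δ ^ _), ← zpow_add, ← sub_eq_add_neg] at h2
  rw [← zpow_add] at h3
  have h4 := tr h2 h3
  convert h4 using 2
  push_cast; ring

theorem T_mono {p : ℤ} {r : ℕ} {y V : G} (hy : LeftDvd P y (Δ ^ (p + r))) {t t' : ℕ} (htt : t ≤ t')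
    (ht : LeftDvd P (y ^ t * V * Δ ^ (-((t : ℤ) * p))) (Δ ^ ((r : ℤ) * t))) :
    LeftDvd P (y ^ t' * V * Δ ^ (-((t' : ℤ) * p))) (Δ ^ ((r : ℤ) * t')) := by
  induction t', htt using Nat.le_induction with
  | base => exact ht
  | succ N _ ih => exact h.T_succ hy ih

theorem YY_le {p : ℤ} {r : ℕ} {y : G} (hy : LeftDvd P y (Δ ^ (p + r))) (t : ℕ) :
    LeftDvd P (YY Δ p y t) (Δ ^ ((r : ℤ) * t)) := by
  have := h.T_mono (V := 1) (t := 0) hy (Nat.zero_le t) (by simpa using rfl' P 1)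
  simpa [YY] using this

theorem AA_one {p : ℤ} {r : ℕ} {y : G} : AA P Δ p r y 1 :=
  ⟨⟨0, by simpa [YY] using rfl' P (1 : G)⟩, 0, by simpa using rfl' P (1 : G)⟩

/-- A bounded `AA` has a greatest element. -/
theorem exists_greatest {p : ℤ} {r : ℕ} {y : G} (hy1 : LeftDvd P (Δ ^ p) y)
    (hy : LeftDvd P y (Δ ^ (p + r))) (b : ℤ) (hb : ∀ V, AA P Δ p r y V → lam V ≤ b) :
    ∃ V, AA P Δ p r y V ∧ ∀ V', AA P Δ p r y V' → LeftDvd P V' V := by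
  obtain ⟨m, ⟨V, hV, rfl⟩, hmax⟩ := Int.exists_greatest_of_bdd
    (P := fun m => ∃ V, AA P Δ p r y V ∧ lam V = m) ⟨b, by rintro z ⟨V, hV, rfl⟩; exact hb V hV⟩
    ⟨_, 1, h.AA_one, rfl⟩
  refine ⟨V, hV, fun V' hV' => ?_⟩
  have hW : AA P Δ p r y (lcm V V') := by
    obtain ⟨⟨M, hM⟩, t, ht⟩ := hV
    obtain ⟨⟨M', hM'⟩, t', ht'⟩ := hV'
    refine ⟨⟨max M M', h.lcm_dvd _ _ _ (tr hM (h.YY_mono hy1 (le_max_left _ _)))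
      (tr hM' (h.YY_mono hy1 (le_max_right _ _)))⟩, max t t', ?_⟩
    have h1 := h.T_mono hy (le_max_left t t') ht
    have h2 := h.T_mono hy (le_max_right t t') ht'
    have key : ∀ z c e : G, ∀ k : ℤ, LeftDvd P (c * z * Δ ^ k) e ↔
        LeftDvd P z (c⁻¹ * e * Δ ^ (-k)) := by
      intro z c e k
      rw [← h.mr k (a := z), ← ml c (b := _ * Δ ^ k)]
      simp [mul_assoc]
    rw [key] at h1 h2 ⊢
    exact h.lcm_dvd _ _ _ h1 h2
  have := h.eq_of_lam (h.left_lcm V V') (hmax _ ⟨_, hW, rfl⟩)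
  rw [this]
  exact h.right_lcm V V'

/-- Closed formula for the conjugating element of an iterated cycling. -/
theorem iter_formula {p : ℤ} {S : G → Prop} {c : G → G}
    (hSc : ∀ y, S y → S (c y))
    (hc : ∀ y, S y → c y = (gcd (y * Δ ^ (-p)) Δ)⁻¹ * y * gcd (y * Δ ^ (-p)) Δ) (k : ℕ) :
    ∀ y, S y → ∃ C, c^[k] y = C⁻¹ * y * C ∧
      ∀ d, LeftDvd P d C ↔ ∀ j : ℕ, j ≤ k → LeftDvd P d (YY Δ p y j * Δ ^ ((k : ℤ) - j)) := by
  induction k with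
  | zero =>
    intro y _
    refine ⟨1, by simp, fun d => ?_⟩
    simp [YY]
  | succ k ih =>
    intro y hy
    obtain ⟨C, h1, h2⟩ := ih (c y) (hSc y hy)
    set ι := gcd (y * Δ ^ (-p)) Δ with hι
    refine ⟨ι * C, ?_, fun d => ?_⟩
    · rw [Function.iterate_succ_apply, h1, hc y hy, ← hι]; group
    · have h3 : LeftDvd P d (ι * C) ↔ LeftDvd P (ι⁻¹ * d) C := by
        rw [← ml ι (a := ι⁻¹ * d)]; simp
      have h4 : ∀ j : ℕ, LeftDvd P (ι⁻¹ * d) (YY Δ p (c y) j * Δ ^ ((k : ℤ) - j)) ↔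
          LeftDvd P d (YY Δ p y (j + 1) * Δ ^ (((k + 1 : ℕ) : ℤ) - (j + 1 : ℕ))) ∧
          LeftDvd P d (YY Δ p y j * Δ ^ (((k + 1 : ℕ) : ℤ) - j)) := by
        intro j
        rw [← ml ι (a := ι⁻¹ * d)]
        have e1 : ι * (YY Δ p (c y) j * Δ ^ ((k : ℤ) - j)) =
            y ^ j * ι * Δ ^ (-((j : ℤ) * p) + ((k : ℤ) - j)) := by
          rw [YY, hc y hy, ← hι]
          have : (ι⁻¹ * y * ι) ^ j = ι⁻¹ * y ^ j * ι := by
            have := conj_pow (a := ι⁻¹) (b := y) (i := j)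
            simpa using this
          rw [this, zpow_add]; group
        rw [e1, hι, h.dvd_gcd_trans, mul_inv_cancel_left]
        rw [h.YY_add p y j 1, h.YY_one]
        unfold YY
        have e2 : y ^ j * (y * Δ ^ (-p)) * Δ ^ (-((j : ℤ) * p)) * Δ ^ (((k + 1 : ℕ) : ℤ) - (j + 1 : ℕ))
          = y ^ j * (y * Δ ^ (-p)) * Δ ^ (-((j : ℤ) * p) + ((k : ℤ) - j)) := by
          rw [mul_assoc _ (Δ ^ _) (Δ ^ _), ← zpow_add]; congr 2; push_cast; ring
        have e3 : y ^ j * Δ * Δ ^ (-((j : ℤ) * p) + ((k : ℤ) - j)) =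
          y ^ j * Δ ^ (-((j : ℤ) * p)) * Δ ^ (((k + 1 : ℕ) : ℤ) - j) := by
          rw [mul_assoc, mul_assoc, ← zpow_one_add, ← zpow_add]; congr 2; push_cast; ring
        rw [e2, e3]
      rw [h3, h2]
      constructor
      · intro H j hj
        rcases Nat.eq_zero_or_pos j with rfl | hj0
        · exact ((h4 0).1 (H 0 (Nat.zero_le _))).2
        · obtain ⟨j, rfl⟩ := Nat.exists_eq_succ_of_ne_zero hj0.ne'
          exact ((h4 j).1 (H j (by omega))).1
      · intro H j hj
        exact (h4 j).2 ⟨H _ (by omega), H _ (by omega)⟩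

end LS
end Garside

namespace Garside

/-- `y^t V Δ^{-tp}`. -/
def EE {G : Type*} [Group G] (Δ : G) (p : ℤ) (y V : G) (t : ℕ) : G :=
  y ^ t * V * Δ ^ (-((t : ℤ) * p))

/-- `V` is the greatest element of `AA`. -/
def GR {G : Type*} [Group G] (P : Submonoid G) (Δ : G) (p : ℤ) (r : ℕ) (y V : G) : Prop :=
  AA P Δ p r y V ∧ ∀ V', AA P Δ p r y V' → LeftDvd P V' V

namespace LS

variable {G : Type*} [Group G] {P : Submonoid G} {Δ : G} {gcd lcm : G → G → G} {lam : G → ℤ}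

theorem EE_YY (p : ℤ) (y : G) (N t : ℕ) : EE Δ p y (YY Δ p y N) t = YY Δ p y (t + N) := by
  unfold EE YY
  rw [pow_add]
  simp only [mul_assoc, ← zpow_add]
  congr 3
  push_cast
  ring

theorem EE_add (p : ℤ) (y V : G) (s t : ℕ) : EE Δ p y V (s + t) = EE Δ p y (EE Δ p y V t) s := by
  unfold EE
  rw [pow_add]
  simp only [mul_assoc, ← zpow_add]
  congr 4
  push_cast
  ring

variable (h : LS P Δ gcd lcm lam)
include h

theorem EE_mono {p : ℤ} {y V W : G} {t : ℕ} :
    LeftDvd P (EE Δ p y V t) (EE Δ p y W t) ↔ LeftDvd P V W := by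
  unfold EE
  rw [h.mr, ml]

theorem dvd_zpow (u : G) : ∃ q : ℕ, LeftDvd P u (Δ ^ (2 * q : ℤ)) := by
  obtain ⟨q, hq⟩ := h.bdd u⁻¹
  refine ⟨q, ?_⟩
  unfold LeftDvd
  rw [← h.cent']
  have : Δ ^ (2 * q : ℤ) * u⁻¹ = Δ ^ q * (Δ ^ q * u⁻¹) := by
    rw [two_mul, zpow_add, zpow_natCast, mul_assoc]
  rw [this]
  exact P.mul_mem (P.pow_mem h.Δ_pos _) hq

theorem conj_pos {x w : G} (hxw : IsConj x w) :
    ∃ u ∈ P, ∃ q : ℕ, LeftDvd P u (Δ ^ (2 * q : ℤ)) ∧ w = u⁻¹ * x * u := by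
  obtain ⟨g, hg⟩ := isConj_iff.1 hxw
  obtain ⟨k, hk⟩ := h.bdd g⁻¹
  refine ⟨Δ ^ (2 * k : ℤ) * g⁻¹, ?_, ?_⟩
  · have : Δ ^ (2 * k : ℤ) * g⁻¹ = Δ ^ k * (Δ ^ k * g⁻¹) := by
      rw [two_mul, zpow_add, zpow_natCast, mul_assoc]
    rw [this]
    exact P.mul_mem (P.pow_mem h.Δ_pos _) hk
  · obtain ⟨q, hq⟩ := h.dvd_zpow (Δ ^ (2 * k : ℤ) * g⁻¹)
    refine ⟨q, hq, ?_⟩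
    rw [← hg]
    have := h.cent' k x
    rw [mul_inv_rev, inv_inv]
    calc g * x * g⁻¹ = g * (Δ ^ (2 * k : ℤ))⁻¹ * (Δ ^ (2 * k : ℤ) * x) * g⁻¹ := by group
      _ = _ := by rw [this]; simp only [mul_assoc]

theorem lam_conj {x w u : G} (hw : w = u⁻¹ * x * u) : lam w = lam x := by
  rw [hw, h.lam_mul, h.lam_mul, h.lam_inv]; ring

theorem conj_pow' (x u : G) (N : ℕ) : u * (u⁻¹ * x * u) ^ N = x ^ N * u := by
  have := conj_pow (a := u⁻¹) (b := x) (i := N)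
  simp only [inv_inv] at this
  rw [this]; group

theorem bound {p : ℤ} {r : ℕ} {x w u : G} {q : ℤ} (hx : LR P Δ p r x) (hw : w = u⁻¹ * x * u)
    (hu : u ∈ P) (huq : LeftDvd P u (Δ ^ q)) {V : G} (hV : AA P Δ p r w V) :
    lam V ≤ q * lam Δ := by
  obtain ⟨⟨M, hM⟩, t, ht⟩ := hV
  have hM' := (h.EE_mono (p := p) (y := w) (t := t)).2 hM
  rw [EE_YY] at hM'
  have h1 := (ml u).2 hM'
  have h2 : u * YY Δ p w (t + M) = x ^ (t + M) * u * Δ ^ (-(((t + M : ℕ) : ℤ) * p)) := by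
    rw [YY, hw, ← mul_assoc, h.conj_pow']
  rw [h2] at h1
  have h3 : LeftDvd P (x ^ (t + M) * u * Δ ^ (-(((t + M : ℕ) : ℤ) * p)))
      (x ^ (t + M) * Δ ^ q * Δ ^ (-(((t + M : ℕ) : ℤ) * p))) := (h.mr _).2 ((ml _).2 huq)
  have h4 := tr h1 h3
  have h5 : x ^ (t + M) * Δ ^ q * Δ ^ (-(((t + M : ℕ) : ℤ) * p)) = YY Δ p x (t + M) * Δ ^ q := by
    rw [YY, mul_assoc, mul_assoc, ← zpow_add, ← zpow_add, add_comm q]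
  rw [h5] at h4
  have h4' : LeftDvd P (u * EE Δ p w V t * Δ ^ (-q)) (YY Δ p x (t + M)) := by
    rw [← h.mr q]; simpa using h4
  have h6 : LeftDvd P (u * EE Δ p w V t * Δ ^ (-q)) (Δ ^ ((r : ℤ) * t)) := by
    rw [← h.mr q]
    have h7 := (ml u).2 ht
    have h8 := (h.mr ((r : ℤ) * t)).2 huq
    have h9 := tr h7 h8
    rw [← zpow_add]
    rw [← zpow_add, add_comm] at h9
    simpa [EE] using h9
  have h10 := h.lam_le (hx.2.2 _ t _ h4' h6)
  have h11 := h.lam_nonneg u hu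
  have h12 := h.lam_conj hw
  simp only [EE, YY, h.lam_mul, h.lam_zpow, h.lam_pow, h12] at h10
  linarith

theorem exists_GR {p : ℤ} {r : ℕ} {x w : G} (hx : LR P Δ p r x) (hxw : IsConj x w)
    (hw1 : LeftDvd P (Δ ^ p) w) (hw2 : LeftDvd P w (Δ ^ (p + r))) : ∃ V, GR P Δ p r w V := by
  obtain ⟨u, hu, q, hq, hw⟩ := h.conj_pos hxw
  exact h.exists_greatest hw1 hw2 _ (fun V hV => h.bound hx hw hu hq hV)

theorem GR_dvd {p : ℤ} {r : ℕ} {w V : G} (hw1 : LeftDvd P (Δ ^ p) w)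
    (hV : GR P Δ p r w V) {M t : ℕ} {d : G} (h1 : LeftDvd P d (YY Δ p w M))
    (h2 : LeftDvd P d (Δ ^ ((r : ℤ) * t))) : LeftDvd P d (EE Δ p w V t) := by
  set V' := (w ^ t)⁻¹ * d * Δ ^ ((t : ℤ) * p) with hV'
  have e : EE Δ p w V' t = d := by
    rw [EE, hV', zpow_neg]; group
  rw [← e, h.EE_mono]
  apply hV.2
  refine ⟨⟨M, ?_⟩, t, ?_⟩
  · rw [← h.EE_mono (t := t), e, EE_YY]
    exact tr h1 (h.YY_mono hw1 (Nat.le_add_left _ _))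
  · change LeftDvd P (EE Δ p w V' t) _
    rwa [e]

theorem GR_pos {p : ℤ} {r : ℕ} {w V : G} (hV : GR P Δ p r w V) : V ∈ P := by
  have := hV.2 1 h.AA_one
  simpa [LeftDvd] using this

theorem EE_conj_even {p : ℤ} (w V : G) (s : ℕ) :
    (EE Δ p w V (2 * s))⁻¹ * w * EE Δ p w V (2 * s) = V⁻¹ * w * V := by
  have h1 := h.cent' (-((s : ℤ) * p)) (V⁻¹ * w * V)
  have h2 : EE Δ p w V (2 * s) = w ^ (2 * s) * V * Δ ^ (2 * -((s : ℤ) * p)) := by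
    unfold EE; congr 2; push_cast; ring
  rw [h2]
  have h3 : (w ^ (2 * s) * V * Δ ^ (2 * -((s : ℤ) * p)))⁻¹ * w *
      (w ^ (2 * s) * V * Δ ^ (2 * -((s : ℤ) * p))) =
      (Δ ^ (2 * -((s : ℤ) * p)))⁻¹ * (V⁻¹ * w * V * Δ ^ (2 * -((s : ℤ) * p))) := by
    generalize Δ ^ (2 * -((s : ℤ) * p)) = D
    have hc : (w ^ (2 * s))⁻¹ * w * w ^ (2 * s) = w := by
      rw [mul_assoc, ← pow_succ', pow_succ]; group
    calc _ = D⁻¹ * (V⁻¹ * ((w ^ (2 * s))⁻¹ * w * w ^ (2 * s)) * V * D) := by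
          simp only [mul_inv_rev, mul_assoc]
      _ = _ := by rw [hc]
  rw [h3, ← h1]; group

theorem thmA {p : ℤ} {r : ℕ} (hr : 2 ≤ r) {S : G → Prop} {c : G → G}
    (hS : ∀ y, S y → LeftDvd P (Δ ^ p) y ∧ LeftDvd P y (Δ ^ (p + r)))
    (hSc : ∀ y, S y → S (c y))
    (hc : ∀ y, S y → c y = (gcd (y * Δ ^ (-p)) Δ)⁻¹ * y * gcd (y * Δ ^ (-p)) Δ)
    {w V : G} (hw : S w) (hV : GR P Δ p r w V) :
    ∃ s1, ∀ s, s1 ≤ s → c^[2 * r * s] w = V⁻¹ * w * V := by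
  obtain ⟨hw1, hw2⟩ := hS w hw
  obtain ⟨K, hK⟩ := hV.1.1
  obtain ⟨t0, ht0⟩ := hV.1.2
  refine ⟨t0 + 2 * K + 1, fun s hs => ?_⟩
  obtain ⟨t, rfl⟩ : ∃ t, t = 2 * s := ⟨_, rfl⟩
  have htl : t0 + 2 * K + 1 ≤ 2 * s := by omega
  rw [show 2 * r * s = r * (2 * s) by ring]
  generalize htt : 2 * s = t at htl
  obtain ⟨C, hC1, hC2⟩ := h.iter_formula hSc hc (r * t) w hw
  have hT : ∀ t', t0 ≤ t' → LeftDvd P (EE Δ p w V t') (Δ ^ ((r : ℤ) * t')) := fun t' ht' =>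
    h.T_mono hw2 ht' ht0
  have hEY : ∀ t', LeftDvd P (EE Δ p w V t') (YY Δ p w (t' + K)) := fun t' => by
    rw [← EE_YY, h.EE_mono]; exact hK
  have hCe : C = EE Δ p w V t := by
    apply h.asymm
    · have a1 := (hC2 C).1 (rfl' P C) (r * t) le_rfl
      have a2 := (hC2 C).1 (rfl' P C) 0 (Nat.zero_le _)
      simp only [sub_self, zpow_zero, mul_one, h.YY_zero, one_mul, Nat.cast_zero, sub_zero] at a1 a2
      push_cast at a2
      exact h.GR_dvd hw1 hV a1 a2
    · rw [hC2]
      intro j hj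
      have hjz : (j : ℤ) ≤ (r : ℤ) * t := by exact_mod_cast hj
      rcases le_or_gt j (t - t0) with hj1 | hj1
      · obtain ⟨m, hm⟩ : ∃ m, t = j + m := ⟨t - j, by omega⟩
        have h1 := (h.EE_mono (y := w) (p := p) (t := j)).2 (hT m (by omega))
        rw [← EE_add, ← hm] at h1
        refine tr h1 ?_
        have e1 : EE Δ p w (Δ ^ ((r : ℤ) * m)) j = YY Δ p w j * Δ ^ ((r : ℤ) * m) := by
          unfold EE YY
          rw [mul_assoc, mul_assoc, ← zpow_add, ← zpow_add, add_comm]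
        rw [e1]
        apply h.zpow_mono'
        have : (j : ℤ) ≤ r * j := by nlinarith
        subst hm
        push_cast
        linarith
      · rcases le_or_gt (t + K) j with hj2 | hj2
        · refine tr (tr (hEY t) (h.YY_mono hw1 hj2)) ?_
          apply le_mul
          obtain ⟨m, hm⟩ : ∃ m : ℕ, ((r * t : ℕ) : ℤ) - j = m := ⟨r * t - j, by omega⟩
          rw [hm, zpow_natCast]
          exact P.pow_mem h.Δ_pos m
        · set d := gcd (EE Δ p w V t) (Δ ^ (j : ℤ)) with hd
          have hd1 : LeftDvd P (EE Δ p w V t) (d * Δ ^ (((r * t : ℕ) : ℤ) - j)) := by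
            have := (h.dvd_gcd_trans (a := EE Δ p w V t) (b := Δ ^ (j : ℤ)) (c := 1)
              (d := EE Δ p w V t) (((r * t : ℕ) : ℤ) - j)).2 ?_
            · rwa [one_mul, ← hd] at this
            · constructor
              · rw [one_mul]
                conv_lhs => rw [← mul_one (EE Δ p w V t), ← zpow_zero Δ]
                apply h.zpow_mono'
                push_cast; omega
              · rw [one_mul, ← zpow_add]
                convert hT t (by omega) using 2
                push_cast; ring
          have hd2 : LeftDvd P d (YY Δ p w j) := by
            have a1 : LeftDvd P d (EE Δ p w V ((j + 1) / 2)) := by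
              refine h.GR_dvd hw1 hV (tr (h.gcd_left _ _) (hEY t)) (tr (h.gcd_right _ _) ?_)
              apply h.zpow_mono
              have a2 : j ≤ r * ((j + 1) / 2) := by
                calc j ≤ 2 * ((j + 1) / 2) := by omega
                  _ ≤ _ := Nat.mul_le_mul_right _ hr
              exact_mod_cast a2
            exact tr a1 (tr (hEY _) (h.YY_mono hw1 (by omega)))
          exact tr hd1 ((h.mr _).2 hd2)
  rw [hC1, hCe, ← htt, h.EE_conj_even]

theorem GR_LR {p : ℤ} {r : ℕ} {w V : G} (hw1 : LeftDvd P (Δ ^ p) w) (hw2 : LeftDvd P w (Δ ^ (p + r)))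
    (hV : GR P Δ p r w V) (h1 : LeftDvd P (Δ ^ p) (V⁻¹ * w * V))
    (h2 : LeftDvd P (V⁻¹ * w * V) (Δ ^ (p + r))) : LR P Δ p r (V⁻¹ * w * V) := by
  refine ⟨h1, h2, fun M s d hd1 hd2 => ?_⟩
  obtain ⟨K, hK⟩ := hV.1.1
  obtain ⟨t0, ht0⟩ := hV.1.2
  set e := EE Δ p w V (2 * t0) with he
  have hv := h.EE_conj_even (p := p) w V t0
  rw [← he] at hv
  rw [← hv] at hd1 ⊢
  have key : ∀ N, e * YY Δ p (e⁻¹ * w * e) N = EE Δ p w e N := fun N => by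
    rw [YY, ← mul_assoc, h.conj_pow', EE]
  rw [← ml e, key] at hd1 ⊢
  rw [he, ← EE_add]
  apply h.GR_dvd (M := M + (2 * t0 + K)) hw1 hV
  · refine tr hd1 ?_
    rw [← EE_YY, h.EE_mono, he, ← EE_YY, h.EE_mono]
    exact hK
  · have a1 : LeftDvd P e (Δ ^ ((r : ℤ) * (2 * t0 : ℕ))) := h.T_mono hw2 (by omega) ht0
    have a2 := tr ((ml e).2 hd2) ((h.mr _).2 a1)
    rw [← zpow_add] at a2
    convert a2 using 2
    push_cast; ring

theorem LR_AA {p : ℤ} {r : ℕ} {y V : G} (hy : LR P Δ p r y) (hV : AA P Δ p r y V) :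
    LeftDvd P V 1 := by
  obtain ⟨⟨M, hM⟩, t, ht⟩ := hV
  have hM' := (h.EE_mono (p := p) (y := y) (t := t)).2 hM
  rw [EE_YY] at hM'
  have := hy.2.2 _ _ _ hM' ht
  rw [show YY Δ p y t = EE Δ p y 1 t by simp [YY, EE], h.EE_mono] at this
  exact this

theorem LR_GR {p : ℤ} {r : ℕ} {y : G} (hy : LR P Δ p r y) : GR P Δ p r y 1 :=
  ⟨h.AA_one, fun _ hV => h.LR_AA hy hV⟩

theorem LR_period {p : ℤ} {r : ℕ} (hr : 2 ≤ r) {S : G → Prop} {c : G → G}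
    (hS : ∀ y, S y → LeftDvd P (Δ ^ p) y ∧ LeftDvd P y (Δ ^ (p + r)))
    (hSc : ∀ y, S y → S (c y))
    (hc : ∀ y, S y → c y = (gcd (y * Δ ^ (-p)) Δ)⁻¹ * y * gcd (y * Δ ^ (-p)) Δ)
    {y : G} (hSy : S y) (hy : LR P Δ p r y) : c^[2 * r] y = y := by
  obtain ⟨s1, hs1⟩ := h.thmA hr hS hSc hc hSy (h.LR_GR hy)
  have a1 := hs1 s1 le_rfl
  have a2 := hs1 (s1 + 1) (by omega)
  rw [mul_add, mul_one, add_comm, Function.iterate_add_apply, a1] at a2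
  simpa using a2

/-- inf and sup cannot be improved. -/
theorem not_inf {p : ℤ} {r : ℕ} {x y : G} (hx : LR P Δ p r x) (hne : x ≠ Δ ^ (p + r))
    (hxy : IsConj x y) : ¬ LeftDvd P (Δ ^ (p + 1)) y := by
  intro hy
  obtain ⟨u, hu, q', hq, hw⟩ := h.conj_pos hxy
  apply hne
  have hN : ∀ N : ℕ, LeftDvd P (Δ ^ (N : ℤ)) (YY Δ p y N) := by
    intro N
    have a1 := h.YY_pos hy N
    have a2 := h.pos_zpow a1 N
    convert a2 using 1
    unfold YY
    rw [mul_assoc, ← zpow_add]; congr 2; ring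
  set q : ℕ := 2 * q' with hqq
  have hq2 : LeftDvd P u (Δ ^ (q : ℤ)) := by simpa [hqq] using hq
  set N := q + r with hNN
  have b1 : LeftDvd P (Δ ^ (N : ℤ)) (YY Δ p x N * Δ ^ (q : ℤ)) := by
    have c1 := (ml u).2 (hN N)
    have c2 := tr (h.pos_zpow hu (N : ℤ)) c1
    refine tr c2 ?_
    rw [hw, YY, ← mul_assoc, h.conj_pow', YY, mul_assoc (x ^ N) (Δ ^ _) (Δ ^ _), ← zpow_add, add_comm,
      zpow_add, ← mul_assoc, h.mr, ml]
    exact hq2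
  have b2 : LeftDvd P (Δ ^ (r : ℤ)) (YY Δ p x N) := by
    rw [← h.mr (q : ℤ), ← zpow_add]
    convert b1 using 2
    rw [hNN]; push_cast; ring
  have b3 := hx.2.2 N 1 _ b2 (by simpa using rfl' P (Δ ^ (r : ℤ)))
  rw [h.YY_one, ← h.mr p, ← zpow_add] at b3
  simp only [inv_mul_cancel_right, zpow_neg, add_comm] at b3
  refine h.asymm hx.2.1 ?_
  exact b3

theorem not_sup {p : ℤ} {r : ℕ} {x y : G} (hx : LR P Δ p r x) (hne : x ≠ Δ ^ p)
    (hxy : IsConj x y) : ¬ LeftDvd P y (Δ ^ (p + (r - 1))) := by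
  intro hy
  obtain ⟨u, hu, q', hq, hw⟩ := h.conj_pos hxy
  apply hne
  set q : ℕ := 2 * q' with hqq
  have hq2 : LeftDvd P u (Δ ^ (q : ℤ)) := by simpa [hqq] using hq
  have hN : ∀ N : ℕ, LeftDvd P (YY Δ p y N) (Δ ^ ((N : ℤ) * (r - 1))) := by
    intro N
    induction N with
    | zero => simpa [YY] using rfl' P (1 : G)
    | succ N ih =>
      have a1 := (h.EE_mono (y := y) (p := p) (t := 1)).2 ih
      rw [EE_YY] at a1
      rw [add_comm N 1]
      refine tr a1 ?_
      have a2 := (h.mr ((N : ℤ) * (r - 1) - p)).2 hy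
      rw [← zpow_add] at a2
      convert a2 using 1
      · rw [EE, pow_one, mul_assoc, ← zpow_add, Nat.cast_one, one_mul, ← sub_eq_add_neg]
      · congr 1; push_cast; ring
  set N := q + r with hNN
  have b1 : LeftDvd P (YY Δ p x N) (Δ ^ ((r : ℤ) * (N - 1 : ℤ))) := by
    have c0 : LeftDvd P (YY Δ p x N) (x ^ N * u * Δ ^ (-((N : ℤ) * p))) := by
      rw [YY, h.mr]; exact le_mul hu
    have c1 := (ml u).2 (hN N)
    rw [hw, YY, ← mul_assoc, h.conj_pow'] at c1
    have c2 := tr (tr c0 c1) ((h.mr _).2 hq2)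
    rw [← zpow_add] at c2
    convert c2 using 2
    rw [hNN]; push_cast; ring
  have hx1 := hx.1
  by_cases hr : r = 0
  · subst hr
    refine (h.asymm hx.1 ?_).symm
    simpa using hx.2.1
  have hN1 : 1 ≤ N := by omega
  obtain ⟨N', hN'⟩ : ∃ N', N = N' + 1 := ⟨N - 1, by omega⟩
  rw [hN'] at b1
  have b2 := hx.2.2 (N' + 1) N' _ (rfl' P _) (by
    convert b1 using 2; push_cast; ring)
  have b3 := h.asymm b2 (h.YY_succ_le hx1 N')
  rw [YY_add h] at b3
  have b4 : x ^ N' * YY Δ p x 1 * Δ ^ (-((N' : ℤ) * p)) = x ^ N' * 1 * Δ ^ (-((N' : ℤ) * p)) := by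
    rw [b3]; simp [YY]
  have b5 := mul_left_cancel (mul_right_cancel b4)
  rw [h.YY_one, zpow_neg, mul_inv_eq_one] at b5
  exact b5

/-- Cycling preserves the summit conditions. -/
theorem cyc_inf {p : ℤ} {y : G} (h1 : LeftDvd P (Δ ^ p) y) :
    LeftDvd P (Δ ^ p) ((gcd (y * Δ ^ (-p)) Δ)⁻¹ * y * gcd (y * Δ ^ (-p)) Δ) := by
  set e := gcd (y * Δ ^ (-p)) Δ with he
  have a1 : LeftDvd P e (y * e * Δ ^ (-p)) := by
    rw [he, h.dvd_gcd_trans, ← he]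
    constructor
    · have b1 := h.gcd_left (y * Δ ^ (-p)) Δ
      rw [← he] at b1
      refine tr b1 ?_
      have b2 := h.YY_succ_le h1 1
      rw [h.YY_one, h.YY_add p y 1 1, h.YY_one] at b2
      simpa using b2
    · refine tr (h.gcd_right _ _) ?_
      have b2 := (h.mr (1 - p)).2 h1
      rw [← zpow_add] at b2
      convert b2 using 1
      · rw [show p + (1 - p) = 1 by ring, zpow_one]
      · rw [mul_assoc, ← zpow_one_add, sub_eq_add_neg]
  have a2 := (ml e⁻¹).2 ((h.mr p).2 a1)
  simpa [mul_assoc] using a2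

theorem cyc_sup {p : ℤ} {r : ℕ} (hr : 1 ≤ r) {y : G}
    (h2 : LeftDvd P y (Δ ^ (p + r))) :
    LeftDvd P ((gcd (y * Δ ^ (-p)) Δ)⁻¹ * y * gcd (y * Δ ^ (-p)) Δ) (Δ ^ (p + r)) := by
  set e := gcd (y * Δ ^ (-p)) Δ with he
  have e1 : LeftDvd P (y * e * Δ ^ (-p)) (y * Δ ^ (1 - p)) := by
    have := (h.mr (-p)).2 ((ml y).2 (h.gcd_right (y * Δ ^ (-p)) Δ))
    rw [← he] at this
    convert this using 1
    rw [mul_assoc, ← zpow_one_add, sub_eq_add_neg]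
  have a1 : LeftDvd P (y * e * Δ ^ (-p)) (1 * e * Δ ^ (r : ℤ)) := by
    rw [he, h.dvd_gcd_trans, ← he]
    constructor
    · refine tr e1 ?_
      rw [one_mul, mul_assoc, ← zpow_add]
      apply h.zpow_mono'
      omega
    · refine tr e1 ?_
      have b2 := (h.mr (1 - p)).2 h2
      rw [← zpow_add] at b2
      convert b2 using 1
      rw [one_mul, ← zpow_one_add]; congr 1; ring
  have a2 := (ml e⁻¹).2 ((h.mr p).2 a1)
  have a3 : e⁻¹ * (y * e * Δ ^ (-p) * Δ ^ p) = e⁻¹ * y * e := by group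
  have a4 : e⁻¹ * (1 * e * Δ ^ (r : ℤ) * Δ ^ p) = Δ ^ (p + r) := by
    rw [add_comm, zpow_add]; group
  rwa [a3, a4] at a2

/-- Round trip. -/
theorem round {p : ℤ} {r : ℕ} {y A B : G} (hy : LR P Δ p r y) (hA : A ∈ P)
    (hA1 : ∃ M : ℕ, Δ ^ (-((M : ℤ) * p)) * y ^ M * A⁻¹ ∈ P)
    (hA2 : ∃ t : ℕ, Δ ^ ((r : ℤ) * t) * (Δ ^ (-((t : ℤ) * p)) * A * y ^ t)⁻¹ ∈ P)
    (hB : GR P Δ p r (A * y * A⁻¹) B) : B⁻¹ * (A * y * A⁻¹) * B = y := by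
  set z := A * y * A⁻¹ with hz
  have hzp : ∀ N : ℕ, z ^ N = A * y ^ N * A⁻¹ := fun N => by rw [hz, conj_pow]
  have hAA : AA P Δ p r z A := by
    refine ⟨?_, ?_⟩
    · obtain ⟨M, hM⟩ := hA1
      refine ⟨M, ?_⟩
      have := h.conjZ ((M : ℤ) * p) hM
      unfold LeftDvd YY
      rw [hzp]
      convert this using 1
      group
    · obtain ⟨t, ht⟩ := hA2
      refine ⟨t, ?_⟩
      unfold LeftDvd
      rw [hzp]
      have h1 := h.conjZ ((t : ℤ) * p - (r : ℤ) * t) ht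
      convert h1 using 1
      have : Δ ^ (((t : ℤ) * p - (r : ℤ) * t)) = Δ ^ ((t : ℤ) * p) * (Δ ^ ((r : ℤ) * t))⁻¹ := by
        rw [zpow_sub]
      rw [zpow_neg, zpow_neg, zpow_sub]
      have h2 : (Δ ^ ((t : ℤ) * p) * (Δ ^ ((r : ℤ) * t))⁻¹)⁻¹ = (Δ ^ ((t : ℤ) * p))⁻¹ * Δ ^ ((r : ℤ) * t) := by
        rw [mul_inv_rev, inv_inv, ← zpow_neg, ← zpow_add, ← zpow_add, add_comm]
      rw [h2]
      generalize Δ ^ ((t : ℤ) * p) = D1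
      generalize Δ ^ ((r : ℤ) * t) = D2
      group
  have hAB := hB.2 A hAA
  set U := A⁻¹ * B with hU
  have hBU : B = A * U := by rw [hU]; group
  have hUA : AA P Δ p r y U := by
    obtain ⟨⟨M, hM⟩, t, ht⟩ := hB.1
    constructor
    · refine ⟨M, ?_⟩
      rw [hBU] at hM
      unfold YY at hM
      rw [hzp, mul_assoc A, mul_assoc A, ml] at hM
      refine tr hM ?_
      unfold YY
      rw [h.mr]
      unfold LeftDvd
      rw [show (y ^ M * A⁻¹)⁻¹ * y ^ M = A by group]
      exact hA
    · refine ⟨t, ?_⟩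
      rw [hBU, hzp, show A * y ^ t * A⁻¹ * (A * U) * Δ ^ (-((t : ℤ) * p)) =
        A * (y ^ t * U * Δ ^ (-((t : ℤ) * p))) by group] at ht
      rw [← ml A]
      exact tr ht (h.pos_zpow hA _)
  have hU1 := h.LR_AA hy hUA
  have hU2 : U = 1 := h.antisymm U hAB (by simpa [LeftDvd] using hU1)
  rw [hBU, hU2, hz]; group

end LS
end Garside

namespace Garside

/-- The list of factors of `YY M`. -/
def LL {G : Type*} (φ : G → G) (l : List G) : ℕ → List G
  | 0 => []
  | M + 1 => l ++ (LL φ l M).map φ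

namespace LS

variable {G : Type*} [Group G] {P : Submonoid G} {Δ : G} {gcd lcm : G → G → G} {lam : G → ℤ}

theorem prod_mem {l : List G} (hs : ∀ s ∈ l, Simple P Δ s) : l.prod ∈ P :=
  P.list_prod_mem (fun s hs' => (hs s hs').1)

variable (h : LS P Δ gcd lcm lam)
include h

theorem prod_le {l : List G} (hs : ∀ s ∈ l, Simple P Δ s) : LeftDvd P l.prod (Δ ^ (l.length : ℤ)) := by
  induction l with
  | nil => simpa using rfl' P (1 : G)
  | cons s l ih =>
    have h1 := (ml s).2 (ih (fun t ht => hs t (by simp [ht])))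
    have h2 := (h.mr (l.length : ℤ)).2 (hs s (by simp)).2
    have := tr h1 h2
    rw [List.prod_cons]
    rw [← zpow_one_add] at this
    convert this using 2
    simp [add_comm]

theorem nf_head {l : List G} (hs : ∀ s ∈ l, Simple P Δ s)
    (hc : l.IsChain (fun s t => gcd (s * t) Δ = s)) :
    ∀ d, LeftDvd P d l.prod → LeftDvd P d Δ → LeftDvd P d (l.headD 1) := by
  induction l with
  | nil => intro d h1 _; simpa using h1
  | cons s l ih =>
    intro d h1 h2
    cases l with
    | nil => simpa using h1
    | cons t l =>
      have hd := ih (fun t ht => hs t (by simp [ht])) (List.isChain_cons_cons.1 hc).2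
      have hw := (List.isChain_cons_cons.1 hc).1
      have hsP := (hs s (by simp)).1
      simp only [List.headD_cons] at hd ⊢
      have a1 : LeftDvd P (s⁻¹ * d) t := by
        apply hd
        · rw [← ml s]; simpa using h1
        · rw [← ml s, mul_inv_cancel_left]
          refine tr h2 ?_
          simpa using h.pos_zpow hsP 1
      rw [← ml s, mul_inv_cancel_left] at a1
      have := h.dvd_gcd _ _ _ a1 h2
      rwa [hw] at this

theorem nf_take {l : List G} (hs : ∀ s ∈ l, Simple P Δ s)
    (hc : l.IsChain (fun s t => gcd (s * t) Δ = s)) :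
    ∀ (k : ℕ) (d : G), LeftDvd P d l.prod → LeftDvd P d (Δ ^ (k : ℤ)) →
      LeftDvd P d (l.take k).prod := by
  induction l with
  | nil => intro k d h1 _; simpa using h1
  | cons s l ih =>
    intro k d h1 h2
    cases k with
    | zero => simpa using h2
    | succ k =>
      rw [List.take_succ_cons, List.prod_cons]
      have a0 := h.nf_head hs hc (gcd d Δ) (tr (h.gcd_left _ _) h1) (h.gcd_right _ _)
      simp only [List.headD_cons] at a0
      have a1 : LeftDvd P d (1 * gcd d Δ * Δ ^ (k : ℤ)) := by
        rw [h.dvd_gcd_trans]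
        constructor
        · rw [one_mul, zpow_natCast]; exact le_mul (P.pow_mem h.Δ_pos k)
        · rw [one_mul, ← zpow_one_add]; convert h2 using 2; push_cast; ring
      rw [one_mul] at a1
      have a2 := tr a1 ((h.mr _).2 a0)
      have a3 := ih (fun t ht => hs t (by simp [ht])) (List.IsChain.tail hc) k (s⁻¹ * d)
        (by rw [← ml s]; simpa using h1) (by rw [← ml s]; simpa using a2)
      rw [← ml s] at a3
      simpa using a3

theorem nf_inf {a : ℤ} {l : List G} {y : G} (hy : IsLeftNF P Δ gcd a l y) :
    LeftDvd P (Δ ^ a) y := by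
  rw [hy.1]; exact le_mul (prod_mem fun s hs => (hy.2.1 s hs).1)

theorem nf_sup {a : ℤ} {l : List G} {y : G} (hy : IsLeftNF P Δ gcd a l y) :
    LeftDvd P y (Δ ^ (a + l.length)) := by
  rw [hy.1, zpow_add, ml]; exact h.prod_le (fun s hs => (hy.2.1 s hs).1)

theorem nf_inf_le (hΔ : Δ ≠ 1) {a b : ℤ} {l : List G} {y : G} (hy : IsLeftNF P Δ gcd a l y)
    (hb : LeftDvd P (Δ ^ b) y) : b ≤ a := by
  by_contra hba
  have h1 : LeftDvd P (Δ ^ (a + 1)) y := tr (h.zpow_mono (by omega)) hb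
  rw [hy.1, zpow_add, ml, zpow_one] at h1
  have h2 := h.nf_head (fun s hs => (hy.2.1 s hs).1) hy.2.2 Δ h1 (rfl' P _)
  cases l with
  | nil =>
    simp [LeftDvd] at h2
    exact hΔ (h.antisymm _ h.Δ_pos h2)
  | cons s l =>
    have hs := hy.2.1 s (by simp)
    exact hs.2.2 (h.asymm hs.1.2 h2)

theorem nf_le_sup (hΔ : Δ ≠ 1) {a b : ℤ} {l : List G} {y : G} (hy : IsLeftNF P Δ gcd a l y)
    (hb : LeftDvd P y (Δ ^ b)) : a + l.length ≤ b := by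
  by_contra hba
  have h1 : LeftDvd P y (Δ ^ (a + (l.length - 1))) := tr hb (h.zpow_mono (by omega))
  rw [hy.1, zpow_add, ml] at h1
  rcases List.eq_nil_or_concat l with rfl | ⟨l', s, rfl⟩
  · simp [LeftDvd] at h1
    exact hΔ (h.antisymm _ h.Δ_pos h1)
  · simp only [List.concat_eq_append] at *
    have h2 := h.nf_take (fun s hs => (hy.2.1 s hs).1) hy.2.2 l'.length _ (rfl' P _) (by
      convert h1 using 2; simp)
    simp [LeftDvd] at h2
    have hs := hy.2.1 s (by simp)
    exact hs.2.1 (h.antisymm _ hs.1.1 h2)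

theorem Δ_ne_one {s : G} (hs : Simple P Δ s) (hs1 : s ≠ 1) : Δ ≠ 1 := by
  intro hΔ
  apply hs1
  apply h.antisymm _ hs.1
  have := hs.2
  rw [hΔ] at this
  simpa [LeftDvd] using this

theorem nf_Δ_ne_one {a : ℤ} {l : List G} {y : G} (hy : IsLeftNF P Δ gcd a l y) (hl : l ≠ []) :
    Δ ≠ 1 := by
  obtain ⟨s, l', rfl⟩ := List.exists_cons_of_ne_nil hl
  have hs := hy.2.1 s (by simp)
  exact h.Δ_ne_one hs.1 hs.2.1

theorem conj_dvd {a b : G} (k : ℤ) : LeftDvd P a (Δ ^ k * b * Δ ^ (-k)) ↔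
    LeftDvd P (Δ ^ (-k) * a * Δ ^ k) b := by
  rw [← h.mr k (b := Δ ^ k * b * Δ ^ (-k)), ← ml (Δ ^ k) (b := b)]
  rw [show Δ ^ k * (Δ ^ (-k) * a * Δ ^ k) = a * Δ ^ k by group,
    show Δ ^ k * b * Δ ^ (-k) * Δ ^ k = Δ ^ k * b by group]

theorem eq_of_dvd_iff {a b : G} (hab : ∀ d, LeftDvd P d a ↔ LeftDvd P d b) : a = b :=
  h.asymm ((hab a).1 (rfl' P a)) ((hab b).2 (rfl' P b))

theorem conj_Δ (k : ℤ) : Δ ^ k * Δ * Δ ^ (-k) = Δ := by group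

theorem gcd_conj (k : ℤ) (a b : G) : gcd (Δ ^ k * a * Δ ^ (-k)) (Δ ^ k * b * Δ ^ (-k)) =
    Δ ^ k * gcd a b * Δ ^ (-k) := by
  apply h.eq_of_dvd_iff
  intro d
  rw [h.dvd_gcd_iff, h.conj_dvd, h.conj_dvd, h.conj_dvd, h.dvd_gcd_iff]

theorem iota_formula {a : ℤ} {l : List G} {y : G} (hy : IsLeftNF P Δ gcd a l y) :
    Δ ^ a * l.headD 1 * Δ ^ (-a) = gcd (y * Δ ^ (-a)) Δ := by
  have e : gcd (y * Δ ^ (-a)) Δ = Δ ^ a * gcd l.prod Δ * Δ ^ (-a) := by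
    rw [← h.gcd_conj, h.conj_Δ, hy.1]
  rw [e]
  congr 2
  apply h.asymm
  · apply h.dvd_gcd
    · cases l with
      | nil => simpa using rfl' P (1 : G)
      | cons s l =>
        simp only [List.headD_cons, List.prod_cons]
        exact le_mul (prod_mem fun t ht => (hy.2.1 t (by simp [ht])).1)
    · cases l with
      | nil => simpa [LeftDvd] using h.Δ_pos
      | cons s l => exact (hy.2.1 s (by simp)).1.2
  · exact h.nf_head (fun s hs => (hy.2.1 s hs).1) hy.2.2 _ (h.gcd_left _ _) (h.gcd_right _ _)

theorem map_prod (p : ℤ) (l : List G) : (l.map (fun a => Δ ^ p * a * Δ ^ (-p))).prod =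
    Δ ^ p * l.prod * Δ ^ (-p) := by
  induction l with
  | nil => simp
  | cons s l ih => rw [List.map_cons, List.prod_cons, ih, List.prod_cons]; group

theorem map_simple (p : ℤ) {l : List G} (hs : ∀ s ∈ l, Simple P Δ s) :
    ∀ s ∈ l.map (fun a => Δ ^ p * a * Δ ^ (-p)), Simple P Δ s := by
  intro s hs'
  obtain ⟨t, ht, rfl⟩ := List.mem_map.1 hs'
  refine ⟨h.conjZ p (hs t ht).1, ?_⟩
  rw [← h.mr p, ← ml (Δ ^ (-p))]
  have := (h.mr p).2 (hs t ht).2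
  have := (hs t ht).2
  convert this using 1 <;> group

theorem map_chain (p : ℤ) {l : List G} (hc : l.IsChain (fun s t => gcd (s * t) Δ = s)) :
    (l.map (fun a => Δ ^ p * a * Δ ^ (-p))).IsChain (fun s t => gcd (s * t) Δ = s) := by
  rw [List.isChain_map]
  refine hc.imp ?_
  intro a b hab
  have := h.gcd_conj p (a * b) Δ
  rw [h.conj_Δ, hab] at this
  rwa [show Δ ^ p * (a * b) * Δ ^ (-p) =
    (Δ ^ p * a * Δ ^ (-p)) * (Δ ^ p * b * Δ ^ (-p)) by group] at this

theorem LR_of_rigid {p : ℤ} {l : List G} {y ι : G} (hy : IsLeftNF P Δ gcd p l y) (hne : l ≠ [])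
    (hι : ι = Δ ^ p * l.headD 1 * Δ ^ (-p)) (hrig : IsLeftNF P Δ gcd p (l ++ [ι]) (y * ι)) :
    LR P Δ p l.length y := by
  refine ⟨h.nf_inf hy, h.nf_sup hy, ?_⟩
  set φ : G → G := fun a => Δ ^ p * a * Δ ^ (-p) with hφ
  set l' := l.map φ with hl'
  have hlen : l'.length = l.length := by simp [hl']
  have hs' : ∀ s ∈ l', Simple P Δ s := h.map_simple p (fun s hs => (hy.2.1 s hs).1)
  have hc' : l'.IsChain (fun s t => gcd (s * t) Δ = s) := h.map_chain p hy.2.2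
  have hprod : ∀ M, (LL φ l' M).prod = YY Δ p y M := by
    intro M
    induction M with
    | zero => simp [LL, YY]
    | succ M ih =>
      rw [LL, List.prod_append, h.map_prod, h.map_prod, ih, add_comm M 1, h.YY_add, hy.1]
      simp only [pow_one, Nat.cast_one, one_mul]
      group
  have hsimp : ∀ M, ∀ s ∈ LL φ l' M, Simple P Δ s := by
    intro M
    induction M with
    | zero => simp [LL]
    | succ M ih =>
      intro s hs
      rw [LL, List.mem_append] at hs
      rcases hs with hs | hs
      · exact hs' s hs
      · exact h.map_simple p ih s hs
  obtain ⟨s0, l0, hl0⟩ := List.exists_cons_of_ne_nil hne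
  have hl'0 : l' = ι :: l0.map φ := by
    rw [hl', hl0, hι, hl0]; simp [hφ]
  have hhead : ∀ M, ∀ s ∈ (LL φ l' M).head?, s = ι := by
    intro M s hs
    cases M with
    | zero => simp [LL] at hs
    | succ M => rw [LL, hl'0] at hs; simp at hs; exact hs.symm
  have hchain : ∀ M, (LL φ l' M).IsChain (fun s t => gcd (s * t) Δ = s) := by
    intro M
    induction M with
    | zero => simp [LL]
    | succ M ih =>
      rw [LL, List.isChain_append]
      refine ⟨hc', h.map_chain p ih, ?_⟩
      intro a ha b hb
      have hb' : b = φ ι := by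
        rw [List.head?_map] at hb
        obtain ⟨b', hb1, rfl⟩ := Option.map_eq_some_iff.1 hb
        rw [hhead M b' hb1]
      rw [hl', List.getLast?_map] at ha
      obtain ⟨a', ha1, rfl⟩ := Option.map_eq_some_iff.1 ha
      have hw := (List.isChain_append.1 hrig.2.2).2.2 a' ha1 ι (by simp)
      have hab := h.map_chain p (l := [a', ι]) (by simpa using hw)
      subst hb'
      exact (List.isChain_cons_cons.1 hab).1
  have htake : ∀ M t, t ≤ M → (LL φ l' M).take (l.length * t) = LL φ l' t := by
    intro M
    induction M with
    | zero => intro t ht; obtain rfl : t = 0 := by omega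
              simp [LL]
    | succ M ih =>
      intro t ht
      cases t with
      | zero => simp [LL]
      | succ t =>
        rw [LL, LL, ← ih t (by omega), List.take_append, hlen,
          show l.length * (t + 1) - l.length = l.length * t by rw [mul_add, mul_one]; omega,
          List.take_of_length_le (by rw [hlen]; nlinarith), List.map_take]
  intro M t d h1 h2
  rcases le_total M t with hMt | hMt
  · exact tr h1 (h.YY_mono (h.nf_inf hy) hMt)
  · rw [← hprod] at h1 ⊢
    rw [← htake M t hMt]
    exact h.nf_take (hsimp M) (hchain M) _ d h1 (by push_cast; exact h2)

theorem nf_ne1 {p : ℤ} {l : List G} {y : G} (hy : IsLeftNF P Δ gcd p l y) (hne : l ≠ []) :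
    y ≠ Δ ^ p := by
  intro e
  have := h.nf_le_sup (h.nf_Δ_ne_one hy hne) hy (b := p) (by rw [e]; exact rfl' P _)
  have h2 := List.length_pos_iff.2 hne
  omega

theorem nf_ne2 {p : ℤ} {l : List G} {y : G} (hy : IsLeftNF P Δ gcd p l y) (hne : l ≠ []) :
    y ≠ Δ ^ (p + l.length) := by
  intro e
  have := h.nf_inf_le (h.nf_Δ_ne_one hy hne) hy (b := p + l.length) (by rw [e]; exact rfl' P _)
  have h2 := List.length_pos_iff.2 hne
  omega

end LS
end Garside

namespace Garside

section BraidWords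

variable {G : Type*} [Group G]

/-- `s_{k-1} ⋯ s_0`. -/
def EW (s : ℕ → G) : ℕ → G
  | 0 => 1
  | k + 1 => s k * EW s k

/-- `(s_0)(s_1 s_0) ⋯ (s_{k-1} ⋯ s_0)`. -/
def DW (s : ℕ → G) : ℕ → G
  | 0 => 1
  | k + 1 => DW s k * EW s (k + 1)

variable {s : ℕ → G} {m : ℕ} (hcomm : ∀ i j, i + 1 < j → j < m → s i * s j = s j * s i)
  (hbr : ∀ i, i + 1 < m → s i * s (i + 1) * s i = s (i + 1) * s i * s (i + 1))
include hcomm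

theorem EW_comm (k : ℕ) : ∀ j, k < j → j < m → EW s k * s j = s j * EW s k := by
  induction k with
  | zero => intro j _ _; simp [EW]
  | succ k ih =>
    intro j hj hjm
    rw [EW, mul_assoc, ih j (by omega) hjm, ← mul_assoc, hcomm k j hj hjm, mul_assoc]

theorem DW_comm (k : ℕ) : ∀ j, k < j → j < m → DW s k * s j = s j * DW s k := by
  induction k with
  | zero => intro j _ _; simp [DW]
  | succ k ih =>
    intro j hj hjm
    rw [DW, mul_assoc, EW_comm hcomm _ j hj hjm, ← mul_assoc, ih j (by omega) hjm, mul_assoc]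

include hbr

theorem EW_shift (k : ℕ) : ∀ i, i + 1 < k → k ≤ m → EW s k * s (i + 1) = s i * EW s k := by
  induction k with
  | zero => intro i hi; omega
  | succ k ih =>
    intro i hi hk
    rcases Nat.lt_or_ge (i + 1) k with h1 | h1
    · rw [EW, mul_assoc, ih i h1 (by omega), ← mul_assoc, ← hcomm i k h1 (by omega), mul_assoc]
    · obtain rfl : k = i + 1 := by omega
      rw [EW, EW, mul_assoc, mul_assoc, EW_comm hcomm i (i + 1) (by omega) (by omega),
        ← mul_assoc, ← mul_assoc, ← hbr i (by omega)]
      simp only [mul_assoc]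

theorem EW_mul (k : ℕ) (hk : k ≤ m) : ∀ j, j + 1 ≤ k →
    EW s k * EW s (j + 1) = EW s j * EW s k * s 0 := by
  intro j
  induction j with
  | zero => intro _; simp [EW]
  | succ j ih =>
    intro hj
    rw [EW, ← mul_assoc, EW_shift hcomm hbr k j (by omega) hk, mul_assoc, ih (by omega), EW]
    simp only [mul_assoc]

theorem DW_conj (k : ℕ) : ∀ i j, i + j + 1 = k → k ≤ m → DW s k * s i = s j * DW s k := by
  induction k with
  | zero => intro i j h; omega
  | succ k ih =>
    intro i j hij hk
    cases i with
    | succ i =>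
      rw [DW, mul_assoc, EW_shift hcomm hbr (k + 1) i (by omega) hk, ← mul_assoc,
        ih i j (by omega) (by omega), mul_assoc]
    | zero =>
      obtain rfl : j = k := by omega
      cases j with
      | zero => simp [DW, EW]
      | succ k' =>
        have h1 := EW_mul hcomm hbr (k' + 1 + 1) hk (k' + 1) le_rfl
        have h2 := DW_comm hcomm k' (k' + 1) (by omega) (by omega)
        calc DW s (k' + 1 + 1) * s 0
            = DW s k' * (EW s (k' + 1) * EW s (k' + 1 + 1) * s 0) := by
              simp only [DW, mul_assoc]
          _ = DW s k' * s (k' + 1) * EW s (k' + 1) * EW s (k' + 1 + 1) := by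
              rw [← h1]
              conv_lhs => rw [show EW s (k' + 1 + 1) * EW s (k' + 1 + 1) =
                s (k' + 1) * EW s (k' + 1) * EW s (k' + 1 + 1) from rfl]
              simp only [mul_assoc]
          _ = _ := by rw [h2]; simp only [DW, mul_assoc]

end BraidWords

/-- Artin generators indexed by all naturals (trivial out of range). -/
noncomputable def sN (n : ℕ) (i : ℕ) : BraidGroup n :=
  if hi : i < n - 1 then σB n ⟨i, hi⟩ else 1

theorem sN_coe (n : ℕ) (i : Fin (n - 1)) : sN n i = σB n i := by simp [sN]

theorem braid_comm (n : ℕ) (i j : Fin (n - 1)) (hij : (i : ℕ) + 1 < j) :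
    σB n i * σB n j = σB n j * σB n i := by
  have : (PresentedGroup.mk (braidRels (n - 1))
      (FreeGroup.of i * FreeGroup.of j * (FreeGroup.of i)⁻¹ * (FreeGroup.of j)⁻¹)) = 1 :=
    PresentedGroup.one_of_mem (Or.inl ⟨i, j, hij, rfl⟩)
  simp only [map_mul, map_inv] at this
  change σB n i * σB n j * (σB n i)⁻¹ * (σB n j)⁻¹ = 1 at this
  rw [mul_inv_eq_one, mul_inv_eq_iff_eq_mul] at this
  exact this

theorem braid_rel (n : ℕ) (i j : Fin (n - 1)) (hij : (i : ℕ) + 1 = j) :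
    σB n i * σB n j * σB n i = σB n j * σB n i * σB n j := by
  have : (PresentedGroup.mk (braidRels (n - 1))
      (FreeGroup.of i * FreeGroup.of j * FreeGroup.of i *
              (FreeGroup.of j * FreeGroup.of i * FreeGroup.of j)⁻¹)) = 1 :=
    PresentedGroup.one_of_mem (Or.inr ⟨i, j, hij, rfl⟩)
  rw [map_mul, map_inv, mul_inv_eq_one] at this
  exact this

theorem sN_comm (n i j : ℕ) (hij : i + 1 < j) (hj : j < n - 1) :
    sN n i * sN n j = sN n j * sN n i := by
  rw [sN, sN, dif_pos hj, dif_pos (by omega)]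
  exact braid_comm n _ _ hij

theorem sN_rel (n i : ℕ) (hi : i + 1 < n - 1) :
    sN n i * sN n (i + 1) * sN n i = sN n (i + 1) * sN n i * sN n (i + 1) := by
  rw [sN, sN, dif_pos hi, dif_pos (by omega)]
  exact braid_rel n _ _ rfl

theorem range_rev_prod {G : Type*} [Group G] (s : ℕ → G) (k : ℕ) :
    ((List.range k).reverse.map s).prod = EW s k := by
  induction k with
  | zero => simp [EW]
  | succ k ih => rw [List.range_succ, EW, ← ih]; simp

theorem range_DW {G : Type*} [Group G] (s : ℕ → G) (k : ℕ) :
    ((List.range k).map fun i => EW s (i + 1)).prod = DW s k := by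
  induction k with
  | zero => simp [DW]
  | succ k ih => rw [List.range_succ, DW, ← ih]; simp

theorem filter_range (m k : ℕ) (hk : k < m) :
    (List.range m).filter (fun j => decide (j ≤ k)) = List.range (k + 1) := by
  induction m, hk using Nat.le_induction with
  | base =>
    rw [List.filter_eq_self]
    intro a ha
    simpa [Nat.lt_succ_iff] using ha
  | succ m hm ih =>
    rw [List.range_succ, List.filter_append, ih]
    simp; omega

theorem halfTwist_eq (n : ℕ) : halfTwist n = DW (sN n) (n - 1) := by
  rw [← range_DW, halfTwist, ← List.map_coe_finRange_eq_range, List.map_map]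
  congr 1
  apply List.map_congr_left
  intro k _
  rw [Function.comp_apply, ← range_rev_prod, ← filter_range (n - 1) k k.2,
    ← List.map_coe_finRange_eq_range, List.filter_map, ← List.map_reverse, List.map_map]
  congr 1
  apply List.map_congr_left
  intro j _
  exact (sN_coe n j).symm

theorem half_conj (n : ℕ) (i : Fin (n - 1)) :
    ∃ j, halfTwist n * σB n i = σB n j * halfTwist n ∧ halfTwist n * σB n j = σB n i * halfTwist n := by
  have hi := i.2
  have hj : n - 1 - 1 - i < n - 1 := by omega
  refine ⟨⟨n - 1 - 1 - i, hj⟩, ?_, ?_⟩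
  · rw [halfTwist_eq, ← sN_coe, ← sN_coe]
    exact DW_conj (sN_comm n) (sN_rel n) (n - 1) _ _ (by simp only; omega) le_rfl
  · rw [halfTwist_eq, ← sN_coe, ← sN_coe]
    exact DW_conj (sN_comm n) (sN_rel n) (n - 1) _ _ (by simp only; omega) le_rfl

theorem half_cent (n : ℕ) (g : BraidGroup n) : halfTwist n ^ 2 * g = g * halfTwist n ^ 2 := by
  have hg : g ∈ Subgroup.centralizer {halfTwist n ^ 2} := by
    have : (⊤ : Subgroup (BraidGroup n)) ≤ Subgroup.centralizer {halfTwist n ^ 2} := by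
      rw [← PresentedGroup.closure_range_of (braidRels (n - 1)), Subgroup.closure_le]
      rintro _ ⟨i, rfl⟩
      rw [SetLike.mem_coe, Subgroup.mem_centralizer_singleton_iff]
      obtain ⟨j, h1, h2⟩ := half_conj n i
      change σB n i * halfTwist n ^ 2 = halfTwist n ^ 2 * σB n i
      rw [pow_two, mul_assoc (halfTwist n), h1, ← mul_assoc, ← mul_assoc, h2]
    exact this (Subgroup.mem_top g)
  exact (Subgroup.mem_centralizer_singleton_iff.1 hg).symm

theorem half_pos_conj (n : ℕ) (a : BraidGroup n) (ha : a ∈ Submonoid.closure (Set.range (σB n))) :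
    halfTwist n * a * (halfTwist n)⁻¹ ∈ Submonoid.closure (Set.range (σB n)) := by
  induction ha using Submonoid.closure_induction with
  | mem x hx =>
    obtain ⟨i, rfl⟩ := hx
    obtain ⟨j, h1, _⟩ := half_conj n i
    rw [h1, mul_inv_cancel_right]
    exact Submonoid.subset_closure ⟨j, rfl⟩
  | one => simp
  | mul x y _ _ hx hy =>
    have := mul_mem hx hy
    rwa [show halfTwist n * x * (halfTwist n)⁻¹ * (halfTwist n * y * (halfTwist n)⁻¹) =
      halfTwist n * (x * y) * (halfTwist n)⁻¹ by group] at this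

/-- The abelianized length. -/
noncomputable def blam (n : ℕ) : BraidGroup n →* Multiplicative ℤ :=
  PresentedGroup.toGroup (f := fun _ => Multiplicative.ofAdd (1 : ℤ)) (by
    rintro r (⟨i, j, _, rfl⟩ | ⟨i, j, _, rfl⟩) <;>
      (simp only [map_mul, map_inv, FreeGroup.lift_apply_of]; group))

theorem blam_σ (n : ℕ) (i : Fin (n - 1)) : blam n (σB n i) = Multiplicative.ofAdd 1 :=
  PresentedGroup.toGroup.of _

theorem blam_pos (n : ℕ) (a : BraidGroup n) (ha : a ∈ Submonoid.closure (Set.range (σB n))) :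
    a = 1 ∨ 1 ≤ (blam n a).toAdd := by
  induction ha using Submonoid.closure_induction with
  | mem x hx =>
    obtain ⟨i, rfl⟩ := hx
    right; rw [blam_σ]; simp
  | one => left; rfl
  | mul x y _ _ hx hy =>
    rcases hx with rfl | hx
    · simpa using hy
    · rcases hy with rfl | hy
      · right; simpa using hx
      · right; rw [map_mul, toAdd_mul]; omega

section Structures

variable {n : ℕ} {𝒢 : GarsideGroup (BraidGroup n)} (h𝒢 : IsBraidGarside n 𝒢)
include h𝒢

theorem bconj (a : BraidGroup n) (ha : a ∈ 𝒢.pos) : 𝒢.Δ * a * 𝒢.Δ⁻¹ ∈ 𝒢.pos := by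
  rw [h𝒢.1] at ha ⊢
  rw [h𝒢.2]
  exact half_pos_conj n a ha

theorem bcent (g : BraidGroup n) : 𝒢.Δ ^ 2 * g = g * 𝒢.Δ ^ 2 := by
  rw [h𝒢.2]; exact half_cent n g

theorem bconj' (a : BraidGroup n) (ha : a ∈ 𝒢.pos) : 𝒢.Δ⁻¹ * a * 𝒢.Δ ∈ 𝒢.pos := by
  have h1 := bconj h𝒢 a ha
  have h2 := bcent h𝒢 a
  have : 𝒢.Δ⁻¹ * a * 𝒢.Δ = 𝒢.Δ * a * 𝒢.Δ⁻¹ := by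
    rw [mul_assoc, inv_mul_eq_iff_eq_mul, ← mul_assoc, ← mul_assoc, eq_mul_inv_iff_mul_eq,
      mul_assoc, ← pow_two, h2]
  rwa [this]

theorem zpow_pos_mem (a : ℤ) : 𝒢.Δ ^ a.natAbs * 𝒢.Δ ^ a ∈ 𝒢.pos := by
  obtain ⟨k, hk⟩ : ∃ k : ℕ, (a.natAbs : ℤ) + a = k := ⟨(a.natAbs + a).toNat, by omega⟩
  rw [← zpow_natCast, ← zpow_add, hk, zpow_natCast]
  exact pow_mem 𝒢.Δ_pos k

theorem LS_left : LS 𝒢.pos 𝒢.Δ 𝒢.gcdL 𝒢.lcmL (fun g => (blam n g).toAdd) where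
  antisymm := 𝒢.pos_antisymm
  Δ_pos := 𝒢.Δ_pos
  gcd_left := 𝒢.gcdL_dvd_left
  gcd_right := 𝒢.gcdL_dvd_right
  dvd_gcd := 𝒢.dvd_gcdL
  left_lcm := 𝒢.dvd_lcmL_left
  right_lcm := 𝒢.dvd_lcmL_right
  lcm_dvd := 𝒢.lcmL_dvd
  conj := bconj h𝒢
  cent := bcent h𝒢
  lam_mul := by intro a b; simp
  lam_nonneg := by
    intro a ha
    rw [h𝒢.1] at ha
    rcases blam_pos n a ha with rfl | h
    · simp
    · omega
  lam_zero := by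
    intro a ha h0
    rw [h𝒢.1] at ha
    rcases blam_pos n a ha with rfl | h
    · rfl
    · omega
  bdd := by
    intro g
    obtain ⟨⟨a, l⟩, hl⟩ := 𝒢.lnf_exists g
    refine ⟨a.natAbs, ?_⟩
    rw [hl.1, ← mul_assoc]
    exact mul_mem (zpow_pos_mem h𝒢 a) (LS.prod_mem fun s hs => (hl.2.1 s hs).1)

open MulOpposite in
theorem LS_right : LS (𝒢.pos.op) (op 𝒢.Δ) (fun a b => op (𝒢.gcdR a.unop b.unop))
    (fun a b => op (𝒢.lcmR a.unop b.unop)) (fun g => (blam n g.unop).toAdd) where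
  antisymm := by
    intro a ha ha'
    have := 𝒢.pos_antisymm a.unop ha ha'
    exact unop_injective this
  Δ_pos := 𝒢.Δ_pos
  gcd_left := fun a b => 𝒢.gcdR_dvd_left a.unop b.unop
  gcd_right := fun a b => 𝒢.gcdR_dvd_right a.unop b.unop
  dvd_gcd := fun a b c => 𝒢.dvd_gcdR a.unop b.unop c.unop
  left_lcm := fun a b => 𝒢.dvd_lcmR_left a.unop b.unop
  right_lcm := fun a b => 𝒢.dvd_lcmR_right a.unop b.unop
  lcm_dvd := fun a b c => 𝒢.lcmR_dvd a.unop b.unop c.unop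
  conj := by
    intro a ha
    have := bconj' h𝒢 a.unop ha
    rw [mul_assoc] at this
    exact this
  cent := by
    intro g
    exact unop_injective (bcent h𝒢 g.unop).symm
  lam_mul := by intro a b; simp [add_comm]
  lam_nonneg := fun a ha => (LS_left h𝒢).lam_nonneg a.unop ha
  lam_zero := fun a ha h0 => unop_injective ((LS_left h𝒢).lam_zero a.unop ha h0)
  bdd := by
    intro g
    obtain ⟨⟨a, l⟩, hl⟩ := 𝒢.rnf_exists g.unop
    refine ⟨a.natAbs, ?_⟩
    change g.unop * 𝒢.Δ ^ a.natAbs ∈ 𝒢.pos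
    rw [hl.1, mul_assoc, ← zpow_natCast, zpow_mul_comm, zpow_natCast]
    exact mul_mem (LS.prod_mem fun s hs => (hl.2.1 s hs).1) (zpow_pos_mem h𝒢 a)

end Structures
end Garside

namespace Garside

/-- The super summit condition in terms of the order. -/
def SS {G : Type*} [Group G] (P : Submonoid G) (Δ : G) (p : ℤ) (r : ℕ) (x y : G) : Prop :=
  IsConj x y ∧ LeftDvd P (Δ ^ p) y ∧ LeftDvd P y (Δ ^ (p + r))

namespace LS

variable {G : Type*} [Group G] {P : Submonoid G} {Δ : G} {gcd lcm : G → G → G} {lam : G → ℤ}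

theorem isConj_inv (u y : G) : IsConj y (u⁻¹ * y * u) :=
  isConj_iff.2 ⟨u⁻¹, by simp⟩

variable (h : LS P Δ gcd lcm lam)
include h

theorem SS_c {p : ℤ} {r : ℕ} (hr : 2 ≤ r) {x : G} {c : G → G}
    (hc : ∀ y, SS P Δ p r x y → c y = (gcd (y * Δ ^ (-p)) Δ)⁻¹ * y * gcd (y * Δ ^ (-p)) Δ) :
    ∀ y, SS P Δ p r x y → SS P Δ p r x (c y) := by
  intro y hy
  rw [hc y hy]
  exact ⟨hy.1.trans (isConj_inv _ _), h.cyc_inf hy.2.1, h.cyc_sup (by omega) hy.2.2⟩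

theorem SS_iter {p : ℤ} {r : ℕ} (hr : 2 ≤ r) {x : G} {c : G → G}
    (hc : ∀ y, SS P Δ p r x y → c y = (gcd (y * Δ ^ (-p)) Δ)⁻¹ * y * gcd (y * Δ ^ (-p)) Δ)
    (k : ℕ) : ∀ y, SS P Δ p r x y → SS P Δ p r x (c^[k] y) := by
  induction k with
  | zero => intro y hy; exact hy
  | succ k ih => intro y hy; rw [Function.iterate_succ_apply]; exact ih _ (h.SS_c hr hc y hy)

theorem side {p : ℤ} {r : ℕ} (hr : 2 ≤ r) {x b : G} {c : G → G}
    (hc : ∀ y, SS P Δ p r x y → c y = (gcd (y * Δ ^ (-p)) Δ)⁻¹ * y * gcd (y * Δ ^ (-p)) Δ)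
    (hb : LR P Δ p r b) (hxb : IsConj x b) {y : G} (hy : SS P Δ p r x y) :
    ∃ V, GR P Δ p r y V ∧ LR P Δ p r (V⁻¹ * y * V) ∧ SS P Δ p r x (V⁻¹ * y * V) ∧
      ∃ s1, ∀ s, s1 ≤ s → c^[2 * r * s] y = V⁻¹ * y * V := by
  obtain ⟨V, hV⟩ := h.exists_GR hb (hxb.symm.trans hy.1) hy.2.1 hy.2.2
  obtain ⟨s1, hs1⟩ := h.thmA hr (S := SS P Δ p r x) (fun _ hy => hy.2) (h.SS_c hr hc) hc hy hV
  have hS := h.SS_iter hr hc (2 * r * s1) y hy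
  rw [hs1 s1 le_rfl] at hS
  exact ⟨V, hV, h.GR_LR hy.2.1 hy.2.2 hV hS.2.1 hS.2.2, hS, s1, hs1⟩

theorem side_period {p : ℤ} {r : ℕ} (hr : 2 ≤ r) {x : G} {c : G → G}
    (hc : ∀ y, SS P Δ p r x y → c y = (gcd (y * Δ ^ (-p)) Δ)⁻¹ * y * gcd (y * Δ ^ (-p)) Δ)
    {y : G} (hy : SS P Δ p r x y) (hyL : LR P Δ p r y) : c^[2 * r] y = y :=
  h.LR_period hr (S := SS P Δ p r x) (fun _ hy => hy.2) (h.SS_c hr hc) hc hy hyL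

theorem side_LR {p : ℤ} {r : ℕ} (hr : 2 ≤ r) {x b : G} {c : G → G}
    (hc : ∀ y, SS P Δ p r x y → c y = (gcd (y * Δ ^ (-p)) Δ)⁻¹ * y * gcd (y * Δ ^ (-p)) Δ)
    (hb : LR P Δ p r b) (hxb : IsConj x b) {y : G} (hy : SS P Δ p r x y) {t : ℕ} (ht : 1 ≤ t)
    (hyt : c^[t] y = y) : LR P Δ p r y := by
  obtain ⟨V, _, hV, _, s1, hs1⟩ := h.side hr hc hb hxb hy
  have h1 := hs1 (t * s1) (by nlinarith)
  have h2 : c^[2 * r * (t * s1)] y = y := by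
    rw [show 2 * r * (t * s1) = t * (2 * r * s1) by ring, Function.iterate_mul]
    exact Function.iterate_fixed hyt _
  rw [← h1, h2] at hV
  exact hV

/-- If some iterate `c^{2rt} y` is rigid then it is the limit. -/
theorem side_limit {p : ℤ} {r : ℕ} (hr : 2 ≤ r) {x b : G} {c : G → G}
    (hc : ∀ y, SS P Δ p r x y → c y = (gcd (y * Δ ^ (-p)) Δ)⁻¹ * y * gcd (y * Δ ^ (-p)) Δ)
    (hb : LR P Δ p r b) (hxb : IsConj x b) {y : G} (hy : SS P Δ p r x y) {t : ℕ}
    (hz : LR P Δ p r (c^[2 * r * t] y)) :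
    ∃ V, GR P Δ p r y V ∧ c^[2 * r * t] y = V⁻¹ * y * V := by
  obtain ⟨V, hV, _, _, s1, hs1⟩ := h.side hr hc hb hxb hy
  refine ⟨V, hV, ?_⟩
  have h1 := h.side_period hr hc (h.SS_iter hr hc (2 * r * t) y hy) hz
  rw [← hs1 (s1 + t) (by omega), mul_add, Function.iterate_add_apply, Function.iterate_mul c (2 * r) s1]
  exact (Function.iterate_fixed h1 _).symm

end LS

section Final

open MulOpposite

variable {n : ℕ} {𝒢 : GarsideGroup (BraidGroup n)}

theorem rnf_op {p : ℤ} {l : List (BraidGroup n)} {x : BraidGroup n}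
    (hx : IsRightNF 𝒢.pos 𝒢.Δ 𝒢.gcdR p l x) :
    IsLeftNF 𝒢.pos.op (op 𝒢.Δ) (fun a b => op (𝒢.gcdR a.unop b.unop)) p (l.map op).reverse
      (op x) := by
  refine ⟨?_, ?_, ?_⟩
  · rw [hx.1, op_mul, op_zpow, op_list_prod]
  · intro s hs
    rw [List.mem_reverse, List.mem_map] at hs
    obtain ⟨t, ht, rfl⟩ := hs
    obtain ⟨h1, h2, h3⟩ := hx.2.1 t ht
    refine ⟨⟨h1.1, ((𝒢.divisors_Δ t).1 h1).2⟩, ?_, ?_⟩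
    · intro h; exact h2 (op_injective h)
    · intro h; exact h3 (op_injective h)
  · have := hx.2.2
    change List.IsChain _ _ at this ⊢
    rw [List.isChain_reverse, List.isChain_map]
    refine this.imp ?_
    intro a b hab
    simp [hab]

theorem headD_op (l : List (BraidGroup n)) :
    (l.map op).reverse.headD 1 = op (l.getLast?.getD 1) := by
  rcases List.eq_nil_or_concat l with rfl | ⟨l', s, rfl⟩
  · simp
  · simp

theorem lnf_spec (x : BraidGroup n) :
    IsLeftNF 𝒢.pos 𝒢.Δ 𝒢.gcdL (𝒢.lnf x).1 (𝒢.lnf x).2 x := Classical.choose_spec (𝒢.lnf_exists x)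

theorem rnf_spec (x : BraidGroup n) :
    IsRightNF 𝒢.pos 𝒢.Δ 𝒢.gcdR (𝒢.rnf x).1 (𝒢.rnf x).2 x := Classical.choose_spec (𝒢.rnf_exists x)

theorem agree (x : BraidGroup n) :
    (𝒢.lnf x).1 = (𝒢.rnf x).1 ∧ (𝒢.lnf x).2.length = (𝒢.rnf x).2.length :=
  𝒢.lnf_rnf_agree x _ _ _ _ (lnf_spec x) (rnf_spec x)

theorem iotaR_op (y : BraidGroup n) : op (𝒢.iotaR y) =
    op 𝒢.Δ ^ (𝒢.rnf y).1 * ((𝒢.rnf y).2.map op).reverse.headD 1 * op 𝒢.Δ ^ (-(𝒢.rnf y).1) := by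
  rw [headD_op, GarsideGroup.iotaR, GarsideGroup.tau, op_mul, op_mul, op_zpow, op_zpow, mul_assoc]

theorem isConj_cR (y : BraidGroup n) : IsConj y (𝒢.cR y) := isConj_iff.2 ⟨_, rfl⟩

theorem isConj_cR_iter (k : ℕ) : ∀ y : BraidGroup n, IsConj y ((𝒢.cR)^[k] y) := by
  induction k with
  | zero => intro y; exact IsConj.refl y
  | succ k ih => intro y; rw [Function.iterate_succ_apply]; exact (isConj_cR y).trans (ih _)

theorem isConj_op {G : Type*} [Group G] {x y : G} (hxy : IsConj x y) : IsConj (op x) (op y) := by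
  obtain ⟨g, hg⟩ := isConj_iff.1 hxy
  refine isConj_iff.2 ⟨(op g)⁻¹, ?_⟩
  rw [← hg]
  simp [mul_assoc]

theorem isConj_unop {G : Type*} [Group G] {x y : G} (hxy : IsConj (op x) (op y)) : IsConj x y := by
  obtain ⟨g, hg⟩ := isConj_iff.1 hxy
  refine isConj_iff.2 ⟨(unop g)⁻¹, ?_⟩
  apply op_injective
  rw [← hg]
  simp [mul_assoc]

variable (h𝒢 : IsBraidGarside n 𝒢)
include h𝒢

theorem dvd_op1 (k : ℤ) (y : BraidGroup n) :
    LeftDvd 𝒢.pos.op (op 𝒢.Δ ^ k) (op y) ↔ LeftDvd 𝒢.pos (𝒢.Δ ^ k) y := by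
  have e : LeftDvd 𝒢.pos.op (op 𝒢.Δ ^ k) (op y) ↔ y * (𝒢.Δ ^ k)⁻¹ ∈ 𝒢.pos := by
    unfold LeftDvd
    rw [← op_zpow, ← op_inv, ← op_mul]
    rfl
  rw [e]
  unfold LeftDvd
  constructor
  · intro h1
    have := (LS_left h𝒢).conjZ' k h1
    convert this using 1; group
  · intro h1
    have := (LS_left h𝒢).conjZ k h1
    convert this using 1; group

theorem dvd_op2 (k : ℤ) (y : BraidGroup n) :
    LeftDvd 𝒢.pos.op (op y) (op 𝒢.Δ ^ k) ↔ LeftDvd 𝒢.pos y (𝒢.Δ ^ k) := by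
  have e : LeftDvd 𝒢.pos.op (op y) (op 𝒢.Δ ^ k) ↔ 𝒢.Δ ^ k * y⁻¹ ∈ 𝒢.pos := by
    unfold LeftDvd
    rw [← op_zpow, ← op_inv, ← op_mul]
    rfl
  rw [e]
  unfold LeftDvd
  constructor
  · intro h1
    have := (LS_left h𝒢).conjZ' k h1
    convert this using 1; group
  · intro h1
    have := (LS_left h𝒢).conjZ k h1
    convert this using 1; group

theorem SS_op (p : ℤ) (r : ℕ) (x y : BraidGroup n) :
    SS 𝒢.pos.op (op 𝒢.Δ) p r (op x) (op y) ↔ SS 𝒢.pos 𝒢.Δ p r x y := by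
  unfold SS
  rw [dvd_op1 h𝒢, dvd_op2 h𝒢]
  exact and_congr_left fun _ => ⟨isConj_unop, isConj_op⟩

theorem cL_formula {p : ℤ} {y : BraidGroup n} (hp : (𝒢.lnf y).1 = p) :
    𝒢.cL y = (𝒢.gcdL (y * 𝒢.Δ ^ (-p)) 𝒢.Δ)⁻¹ * y * 𝒢.gcdL (y * 𝒢.Δ ^ (-p)) 𝒢.Δ := by
  have : 𝒢.iotaL y = 𝒢.gcdL (y * 𝒢.Δ ^ (-p)) 𝒢.Δ := by
    subst hp
    rw [← (LS_left h𝒢).iota_formula (lnf_spec y), GarsideGroup.iotaL, GarsideGroup.tau, neg_neg]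
  rw [GarsideGroup.cL, this]

theorem cR_formula {p : ℤ} {y : BraidGroup n} (hp : (𝒢.rnf y).1 = p) :
    op (𝒢.cR y) = (op (𝒢.gcdR (op y * op 𝒢.Δ ^ (-p)).unop (op 𝒢.Δ).unop))⁻¹ * op y *
      op (𝒢.gcdR (op y * op 𝒢.Δ ^ (-p)).unop (op 𝒢.Δ).unop) := by
  have : op (𝒢.iotaR y) = op (𝒢.gcdR (op y * op 𝒢.Δ ^ (-p)).unop (op 𝒢.Δ).unop) := by
    subst hp
    rw [iotaR_op]
    exact (LS_right h𝒢).iota_formula (rnf_op (rnf_spec y))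
  rw [← this, GarsideGroup.cR]
  simp [mul_assoc]

theorem left_rigid_LR {x : BraidGroup n} (hx : 𝒢.LeftRigid x) :
    LR 𝒢.pos 𝒢.Δ (𝒢.lnf x).1 (𝒢.len x) x :=
  (LS_left h𝒢).LR_of_rigid (lnf_spec x) hx.1
    (by rw [GarsideGroup.iotaL, GarsideGroup.tau, neg_neg]) hx.2

theorem right_rigid_LR {x : BraidGroup n} (hx : 𝒢.RightRigid x) :
    LR 𝒢.pos.op (op 𝒢.Δ) (𝒢.lnf x).1 (𝒢.len x) (op x) := by
  have h1 := (LS_right h𝒢).LR_of_rigid (rnf_op (rnf_spec x)) (by simpa using hx.1) (iotaR_op x) (by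
    have := rnf_op hx.2
    simpa using this)
  rw [GarsideGroup.len, (agree x).1, (agree x).2]
  simpa using h1

/-- All facts about inf and sup of conjugates of a left rigid element. -/
theorem conj_bounds {p : ℤ} {r : ℕ} {x : BraidGroup n} (hx : LR 𝒢.pos 𝒢.Δ p r x)
    (h1 : x ≠ 𝒢.Δ ^ p) (h2 : x ≠ 𝒢.Δ ^ (p + r)) {y : BraidGroup n} (hy : IsConj x y) :
    (𝒢.lnf y).1 ≤ p ∧ p + r ≤ (𝒢.lnf y).1 + 𝒢.len y := by
  have H := LS_left h𝒢
  constructor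
  · by_contra hc
    exact H.not_inf hx h2 hy (LS.tr (H.zpow_mono (by omega)) (H.nf_inf (lnf_spec y)))
  · by_contra hc
    refine H.not_sup hx h1 hy (LS.tr (H.nf_sup (lnf_spec y)) (H.zpow_mono ?_))
    simp only [GarsideGroup.len] at hc
    omega

theorem main {x : BraidGroup n} {r : ℕ}
    (hr : 𝒢.len x = r) (hr1 : 1 < r) (hx : 𝒢.LeftRigid x)
    (F : BraidGroup n → BraidGroup n)
    (hF : ∀ y ∈ 𝒢.USSL x, ∃ t : ℕ,
      𝒢.RightRigid ((𝒢.cR)^[2 * r * t] y) ∧ F y = (𝒢.cR)^[2 * r * t] y) :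
    Set.BijOn F (𝒢.USSL x) (𝒢.USSR x) := by
  have H := LS_left h𝒢
  have H' := LS_right h𝒢
  obtain ⟨p, hp⟩ : ∃ p, (𝒢.lnf x).1 = p := ⟨_, rfl⟩
  have hxL : LR 𝒢.pos 𝒢.Δ p r x := by
    have := left_rigid_LR h𝒢 hx
    rwa [hp, hr] at this
  have hne1 : x ≠ 𝒢.Δ ^ p := by rw [← hp]; exact H.nf_ne1 (lnf_spec x) hx.1
  have hne2 : x ≠ 𝒢.Δ ^ (p + r) := by
    rw [← hp, ← hr]; exact H.nf_ne2 (lnf_spec x) hx.1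
  have hΔ : 𝒢.Δ ≠ 1 := H.nf_Δ_ne_one (lnf_spec x) hx.1
  have hcb : ∀ y, IsConj x y → (𝒢.lnf y).1 ≤ p ∧ p + r ≤ (𝒢.lnf y).1 + 𝒢.len y :=
    fun y hy => conj_bounds h𝒢 hxL hne1 hne2 hy
  -- summit elements
  have hSSnf : ∀ y, SS 𝒢.pos 𝒢.Δ p r x y → (𝒢.lnf y).1 = p ∧ 𝒢.len y = r := by
    intro y hy
    have a1 := hcb y hy.1
    have a2 := H.nf_inf_le hΔ (lnf_spec y) hy.2.1
    have a3 := H.nf_le_sup hΔ (lnf_spec y) hy.2.2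
    simp only [GarsideGroup.len] at a1 ⊢
    omega
  have hSSx : SS 𝒢.pos 𝒢.Δ p r x x := ⟨IsConj.refl x, hxL.1, hxL.2.1⟩
  have hSSS : ∀ y, y ∈ 𝒢.SSS x ↔ SS 𝒢.pos 𝒢.Δ p r x y := by
    intro y
    constructor
    · intro hy
      have a1 := hcb y hy.1
      have a2 := hy.2 x (IsConj.refl x)
      have a3 := H.nf_inf (lnf_spec y)
      have a4 := H.nf_sup (lnf_spec y)
      have a5 : (𝒢.lnf y).1 = p := by omega
      have a6 : (𝒢.lnf y).2.length = r := by simp only [GarsideGroup.len] at *; omega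
      rw [a5] at a3 a4
      rw [a6] at a4
      exact ⟨hy.1, a3, a4⟩
    · intro hy
      refine ⟨hy.1, fun z hz => ?_⟩
      have a1 := hcb z hz
      have a2 := hSSnf y hy
      omega
  -- left cycling
  have hcL : ∀ y, SS 𝒢.pos 𝒢.Δ p r x y → 𝒢.cL y =
      (𝒢.gcdL (y * 𝒢.Δ ^ (-p)) 𝒢.Δ)⁻¹ * y * 𝒢.gcdL (y * 𝒢.Δ ^ (-p)) 𝒢.Δ :=
    fun y hy => cL_formula h𝒢 (hSSnf y hy).1
  have hUL : ∀ y, y ∈ 𝒢.USSL x ↔ SS 𝒢.pos 𝒢.Δ p r x y ∧ LR 𝒢.pos 𝒢.Δ p r y := by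
    intro y
    constructor
    · rintro ⟨h1, t, ht, hty⟩
      rw [hSSS] at h1
      exact ⟨h1, H.side_LR hr1 hcL hxL (IsConj.refl x) h1 ht hty⟩
    · rintro ⟨h1, h2⟩
      exact ⟨(hSSS y).2 h1, 2 * r, by omega, H.side_period hr1 hcL h1 h2⟩
  -- right cycling
  set c' : (BraidGroup n)ᵐᵒᵖ → (BraidGroup n)ᵐᵒᵖ := fun y => op (𝒢.cR y.unop) with hc'
  have hc'it : ∀ k y, c'^[k] (op y) = op ((𝒢.cR)^[k] y) := by
    intro k
    induction k with
    | zero => intro y; rfl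
    | succ k ih => intro y; rw [Function.iterate_succ_apply, Function.iterate_succ_apply, ← ih]; rfl
  have hSSop := SS_op h𝒢 p r x
  have hcR : ∀ y, SS 𝒢.pos.op (op 𝒢.Δ) p r (op x) y → c' y =
      (op (𝒢.gcdR (y * op 𝒢.Δ ^ (-p)).unop (op 𝒢.Δ).unop))⁻¹ * y *
        op (𝒢.gcdR (y * op 𝒢.Δ ^ (-p)).unop (op 𝒢.Δ).unop) := by
    intro y hy
    exact cR_formula h𝒢 (y := y.unop) (by
      rw [← (agree y.unop).1]; exact (hSSnf _ ((hSSop _).1 hy)).1)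
  -- right rigid base point
  have hRR : ∀ z, SS 𝒢.pos 𝒢.Δ p r x z → 𝒢.RightRigid z →
      LR 𝒢.pos.op (op 𝒢.Δ) p r (op z) := by
    intro z hz hzr
    have := right_rigid_LR h𝒢 hzr
    rwa [(hSSnf z hz).1, (hSSnf z hz).2] at this
  have hSSR : ∀ k y, SS 𝒢.pos 𝒢.Δ p r x y → SS 𝒢.pos 𝒢.Δ p r x ((𝒢.cR)^[k] y) := by
    intro k y hy
    have := H'.SS_iter hr1 hcR k (op y) ((hSSop y).2 hy)
    rw [hc'it] at this
    exact (hSSop _).1 this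
  obtain ⟨t0, hz0, -⟩ := hF x ((hUL x).2 ⟨hSSx, hxL⟩)
  obtain ⟨z0, hz0e⟩ : ∃ z0, (𝒢.cR)^[2 * r * t0] x = z0 := ⟨_, rfl⟩
  rw [hz0e] at hz0
  have hSz0 : SS 𝒢.pos 𝒢.Δ p r x z0 := by rw [← hz0e]; exact hSSR _ x hSSx
  have hLz0 := hRR z0 hSz0 hz0
  have hcz0 : IsConj (op x) (op z0) := isConj_op hSz0.1
  have hUR : ∀ y, y ∈ 𝒢.USSR x ↔
      SS 𝒢.pos 𝒢.Δ p r x y ∧ LR 𝒢.pos.op (op 𝒢.Δ) p r (op y) := by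
    intro y
    constructor
    · rintro ⟨h1, t, ht, hty⟩
      rw [hSSS] at h1
      refine ⟨h1, H'.side_LR hr1 hcR hLz0 hcz0 ((hSSop y).2 h1) ht ?_⟩
      rw [hc'it, hty]
    · rintro ⟨h1, h2⟩
      refine ⟨(hSSS y).2 h1, 2 * r, by omega, ?_⟩
      have := H'.side_period hr1 hcR ((hSSop y).2 h1) h2
      rw [hc'it] at this
      exact op_injective this
  -- description of F
  have hFd : ∀ y, y ∈ 𝒢.USSL x → SS 𝒢.pos 𝒢.Δ p r x (F y) ∧
      LR 𝒢.pos.op (op 𝒢.Δ) p r (op (F y)) ∧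
      ∃ V, GR 𝒢.pos.op (op 𝒢.Δ) p r (op y) V ∧ op (F y) = V⁻¹ * op y * V := by
    intro y hy
    obtain ⟨t, h1, h2⟩ := hF y hy
    have hyS := ((hUL y).1 hy).1
    have hS : SS 𝒢.pos 𝒢.Δ p r x (F y) := by rw [h2]; exact hSSR _ y hyS
    rw [← h2] at h1
    have hL := hRR _ hS h1
    refine ⟨hS, hL, ?_⟩
    have h3 : c'^[2 * r * t] (op y) = op (F y) := by rw [hc'it, h2]
    rw [← h3] at hL ⊢
    exact H'.side_limit hr1 hcR hLz0 hcz0 ((hSSop y).2 hyS) hL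
  -- round trips
  have rt1 : ∀ y, y ∈ 𝒢.USSL x → ∀ B, GR 𝒢.pos 𝒢.Δ p r (F y) B → B⁻¹ * F y * B = y := by
    intro y hy B hB
    obtain ⟨_, _, V, hV, hFV⟩ := hFd y hy
    have hFy : F y = V.unop * y * (V.unop)⁻¹ := by
      apply op_injective
      rw [hFV]
      simp [mul_assoc]
    rw [hFy] at hB ⊢
    refine H.round ((hUL y).1 hy).2 (H'.GR_pos hV) ?_ ?_ hB
    · obtain ⟨M, hM⟩ := hV.1.1
      exact ⟨M, hM⟩
    · obtain ⟨t, ht⟩ := hV.1.2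
      refine ⟨t, ?_⟩
      have : 𝒢.Δ ^ ((r : ℤ) * t) * (𝒢.Δ ^ (-((t : ℤ) * p)) * (V.unop * y ^ t))⁻¹ ∈ 𝒢.pos := ht
      rwa [← mul_assoc (𝒢.Δ ^ (-((t : ℤ) * p)))] at this
  refine ⟨?_, ?_, ?_⟩
  · intro y hy
    obtain ⟨h1, h2, _⟩ := hFd y hy
    exact (hUR _).2 ⟨h1, h2⟩
  · intro y1 hy1 y2 hy2 he
    have hS := (hFd y1 hy1).1
    obtain ⟨B, hB⟩ := H.exists_GR hxL hS.1 hS.2.1 hS.2.2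
    have e1 := rt1 y1 hy1 B hB
    have e2 := rt1 y2 hy2 B (by rw [← he]; exact hB)
    rw [← e1, ← e2, he]
  · intro z hz
    obtain ⟨hzS, hzL⟩ := (hUR z).1 hz
    obtain ⟨B, hB, hBL, hBS, _⟩ := H.side hr1 hcL hxL (IsConj.refl x) hzS
    have hy := (hUL _).2 ⟨hBS, hBL⟩
    refine ⟨B⁻¹ * z * B, hy, ?_⟩
    obtain ⟨_, _, V, hV, hFV⟩ := hFd _ hy
    have e : op (B⁻¹ * z * B) = op B * op z * (op B)⁻¹ := by simp [mul_assoc]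
    rw [e] at hV hFV
    apply op_injective
    rw [hFV]
    refine H'.round hzL (H.GR_pos hB) ?_ ?_ hV
    · obtain ⟨M, hM⟩ := hB.1.1
      refine ⟨M, ?_⟩
      have : B⁻¹ * (z ^ M * 𝒢.Δ ^ (-((M : ℤ) * p))) ∈ 𝒢.pos := hM
      exact this
    · obtain ⟨t, ht⟩ := hB.1.2
      refine ⟨t, ?_⟩
      have : (z ^ t * B * 𝒢.Δ ^ (-((t : ℤ) * p)))⁻¹ * 𝒢.Δ ^ ((r : ℤ) * t) ∈ 𝒢.pos := ht
      rw [mul_assoc (z ^ t)] at this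
      exact this

end Final
end Garside

namespace Garside

/-- **Proposition 4.14.** Let `x ∈ Bₙ` be a left rigid braid with `ℓ(x) > 1`.
The map `Φ : USS_L(x) → USS_R(x)`, defined by `Φ(y) = c_R^{2rt}(y)` for any
`t ≥ 0` with `c_R^{2rt}(y)` right rigid (`r = ℓ(x)`), is bijective. In
particular `#USS_L(x) = #USS_R(x)`. -/
theorem Phi_bijective {n : ℕ} (𝒢 : GarsideGroup (BraidGroup n))
    (h𝒢 : IsBraidGarside n 𝒢) (x : BraidGroup n) (r : ℕ)
    (hr : 𝒢.len x = r) (hr1 : 1 < r) (hx : 𝒢.LeftRigid x)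
    (F : BraidGroup n → BraidGroup n)
    (hF : ∀ y ∈ 𝒢.USSL x, ∃ t : ℕ,
      𝒢.RightRigid ((𝒢.cR)^[2 * r * t] y) ∧ F y = (𝒢.cR)^[2 * r * t] y) :
    Set.BijOn F (𝒢.USSL x) (𝒢.USSR x) ∧
    Nat.card (𝒢.USSL x) = Nat.card (𝒢.USSR x) := by
  have hb := main h𝒢 hr hr1 hx F hF
  exact ⟨hb, Nat.card_congr (hb.equiv F)⟩

end Garside
end

section
/- Let x ∈ B_n be a left rigid braid with ℓ(x) > 1, and let s be an arrow from x to y in USG_L(x) such that s is a left divisor (prefix) of ι_L(x) (a black arrow, i.e. a partial left cycling). Then Φ(s) is an arrow from Φ(y) to Φ(x) in USG_R(x) such that Φ(s) is a right divisor (suffix) of ι_R(Φ(y)) (a black arrow, i.e. a partial right cycling). Consequently, Φ sends black arrows to black arrows and grey arrows to grey arrows. -/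
namespace Garside

section core

variable {G : Type*} [Group G] {P : Submonoid G} {Δ : G}

/-- Left-weightedness, without reference to a gcd function. -/
def WW (P : Submonoid G) (Δ a b : G) : Prop :=
  ∀ d, LeftDvd P d (a * b) → LeftDvd P d Δ → LeftDvd P d a

theorem LeftDvd.trans' {a b c : G} (h : LeftDvd P a b) (h' : LeftDvd P b c) : LeftDvd P a c := by
  have := P.mul_mem h h'
  unfold LeftDvd
  convert this using 1
  group

theorem head_aux (l : List G) : ∀ a : G, (∀ s ∈ a :: l, Δ⁻¹ * s * Δ ∈ P) →
    List.IsChain (WW P Δ) (a :: l) → ∀ d, LeftDvd P d (a :: l).prod → LeftDvd P d Δ →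
    LeftDvd P d a := by
  induction l with
  | nil => intro a _ _ d h _; simpa using h
  | cons b l ih =>
    intro a hs hc d h1 h2
    rw [List.isChain_cons_cons] at hc
    have hb := ih b (fun s hs' => hs s (List.mem_cons_of_mem _ hs')) hc.2 (a⁻¹ * d)
      (by
        unfold LeftDvd at *
        rw [List.prod_cons] at h1
        convert h1 using 1
        group)
      (by
        unfold LeftDvd at *
        have := P.mul_mem h2 (hs a (by simp))
        convert this using 1
        group)
    refine hc.1 d ?_ h2
    unfold LeftDvd at *
    convert hb using 1
    group

/-- Basic properties of a positive cone with a Garside element. -/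
structure Core (P : Submonoid G) (Δ : G) : Prop where
  anti : ∀ a : G, a ∈ P → a⁻¹ ∈ P → a = 1
  Δpos : Δ ∈ P
  c1 : ∀ a ∈ P, Δ⁻¹ * a * Δ ∈ P
  c2 : ∀ a ∈ P, Δ * a * Δ⁻¹ ∈ P
  lcm : ∀ a b : G, ∃ m, LeftDvd P a m ∧ LeftDvd P b m ∧
    ∀ c, LeftDvd P a c → LeftDvd P b c → LeftDvd P m c

theorem Core.conjN (C : Core P Δ) {a : G} (h : a ∈ P) (k : ℕ) :
    Δ ^ (-(k : ℤ)) * a * Δ ^ (k : ℤ) ∈ P ∧ Δ ^ (k : ℤ) * a * Δ ^ (-(k : ℤ)) ∈ P := by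
  induction k with
  | zero => simpa using h
  | succ k ih =>
    constructor
    · convert C.c1 _ ih.1 using 1
      push_cast
      group
    · convert C.c2 _ ih.2 using 1
      push_cast
      group

theorem Core.conj (C : Core P Δ) {a : G} (h : a ∈ P) (k : ℤ) :
    Δ ^ (-k) * a * Δ ^ k ∈ P := by
  obtain ⟨m, rfl | rfl⟩ := k.eq_nat_or_neg
  · exact (C.conjN h m).1
  · simpa using (C.conjN h m).2

theorem Core.conj_iff (C : Core P Δ) {a : G} (k : ℤ) :
    Δ ^ (-k) * a * Δ ^ k ∈ P ↔ a ∈ P := by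
  refine ⟨fun h => ?_, fun h => C.conj h k⟩
  convert C.conj h (-k) using 1
  group

theorem Core.lconj (C : Core P Δ) {a b : G} (k : ℤ) :
    LeftDvd P (Δ ^ (-k) * a * Δ ^ k) (Δ ^ (-k) * b * Δ ^ k) ↔ LeftDvd P a b := by
  unfold LeftDvd
  rw [← C.conj_iff (a := a⁻¹ * b) k]
  have : (Δ ^ (-k) * a * Δ ^ k)⁻¹ * (Δ ^ (-k) * b * Δ ^ k) = Δ ^ (-k) * (a⁻¹ * b) * Δ ^ k := by
    group
  rw [this]

theorem Core.lconj' (C : Core P Δ) {a b : G} (k : ℤ) :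
    LeftDvd P a (Δ ^ (-k) * b * Δ ^ k) ↔ LeftDvd P (Δ ^ k * a * Δ ^ (-k)) b := by
  rw [← C.lconj (a := Δ ^ k * a * Δ ^ (-k)) k]
  have : Δ ^ (-k) * (Δ ^ k * a * Δ ^ (-k)) * Δ ^ k = a := by group
  rw [this]

theorem Core.WW_conj (C : Core P Δ) {a b : G} (h : WW P Δ a b) (k : ℤ) :
    WW P Δ (Δ ^ (-k) * a * Δ ^ k) (Δ ^ (-k) * b * Δ ^ k) := by
  intro d h1 h2
  rw [C.lconj']
  apply h
  · rw [← C.lconj']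
    convert h1 using 1
    group
  · rw [← C.lconj']
    convert h2 using 1
    group

theorem Core.WW_of (C : Core P Δ) {a b : G} (hb : b ∈ P) (ha : LeftDvd P a Δ)
    (h : ∀ f, LeftDvd P f (a⁻¹ * Δ) → LeftDvd P f b → LeftDvd P f 1) : WW P Δ a b := by
  intro d h1 h2
  obtain ⟨m, hd, ham, hm⟩ := C.lcm d a
  have m1 : LeftDvd P m Δ := hm _ h2 ha
  have m2 : LeftDvd P m (a * b) := hm _ h1 (by unfold LeftDvd; simpa using hb)
  have := h (a⁻¹ * m) (by unfold LeftDvd at *; convert m1 using 1; group)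
    (by unfold LeftDvd at *; convert m2 using 1; group)
  have : LeftDvd P m a := by unfold LeftDvd at *; convert this using 1; group
  exact hd.trans' this

/-- The twisted complements of a list of simples, in reverse order. -/
def invL (Δ : G) : List G → List G
  | [] => []
  | x :: l => invL Δ l ++ [Δ ^ (-(l.length : ℤ)) * (x⁻¹ * Δ) * Δ ^ (l.length : ℤ)]

theorem invL_prod (l : List G) : (invL Δ l).prod = l.prod⁻¹ * Δ ^ (l.length : ℤ) := by
  induction l with
  | nil => simp [invL]
  | cons x l ih =>
    simp only [invL, List.prod_append, ih, List.prod_cons, List.prod_nil, List.length_cons]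
    push_cast
    group

theorem invL_head (l : List G) : (invL Δ l).head? = l.getLast?.map (fun y => y⁻¹ * Δ) := by
  induction l with
  | nil => simp [invL]
  | cons x l ih =>
    cases l with
    | nil => simp [invL]
    | cons y l =>
      rw [invL, List.head?_append, ih, List.getLast?_cons_cons]
      cases h : (y :: l).getLast? with
      | none => simp at h
      | some z => simp

theorem invL_conj (C : Core P Δ) (l : List G) (hs : ∀ s ∈ l, Simple P Δ s) :
    ∀ s ∈ invL Δ l, s ∈ P := by
  induction l with
  | nil => simp [invL]
  | cons x l ih =>
    intro s h
    rw [invL, List.mem_append] at h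
    rcases h with h | h
    · exact ih (fun s h => hs s (List.mem_cons_of_mem _ h)) s h
    · rw [List.mem_singleton] at h
      rw [h]
      exact C.conj (hs x (by simp)).2 _

theorem invL_chain (C : Core P Δ) (l : List G) (hs : ∀ s ∈ l, Simple P Δ s)
    (hc : List.IsChain (WW P Δ) l) : List.IsChain (WW P Δ) (invL Δ l) := by
  induction l with
  | nil => simp [invL]
  | cons x l ih =>
    rw [invL, List.isChain_append]
    refine ⟨ih (fun s h => hs s (List.mem_cons_of_mem _ h)) hc.tail, by simp, ?_⟩
    cases l with
    | nil => simp [invL]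
    | cons y l =>
      intro a ha b hb
      rw [List.isChain_cons_cons] at hc
      simp only [invL, List.getLast?_append, List.getLast?_singleton, Option.some_or,
        Option.mem_def, Option.some.injEq, List.head?_cons, List.length_cons] at ha hb
      subst ha
      subst hb
      have key : WW P Δ (y⁻¹ * Δ) (Δ ^ (-1 : ℤ) * (x⁻¹ * Δ) * Δ ^ (1 : ℤ)) := by
        apply C.WW_of
        · exact C.conj (hs x (by simp)).2 1
        · have := C.c1 _ (hs y (by simp)).1
          unfold LeftDvd
          convert this using 1
          group
        · intro f h1 h2
          rw [C.lconj'] at h2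
          have h1' : LeftDvd P (Δ ^ (1 : ℤ) * f * Δ ^ (-1 : ℤ)) y := by
            rw [← C.lconj']
            convert h1 using 1
            group
          have := hc.1 (x * (Δ ^ (1 : ℤ) * f * Δ ^ (-1 : ℤ)))
            (by unfold LeftDvd at *; convert h1' using 1; group)
            (by unfold LeftDvd at *; convert h2 using 1; group)
          have h3 : LeftDvd P (Δ ^ (1 : ℤ) * f * Δ ^ (-1 : ℤ)) 1 := by
            unfold LeftDvd at *; convert this using 1; group
          rw [← C.lconj'] at h3
          simpa using h3
      convert C.WW_conj key (l.length : ℤ) using 1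
      push_cast
      group

theorem Core.last (C : Core P Δ) (l : List G) (hs : ∀ s ∈ l, Simple P Δ s)
    (hc : List.IsChain (WW P Δ) l) (d y : G) (hy : y ∈ l.getLast?) (h1 : LeftDvd P d Δ)
    (h2 : LeftDvd P d (l.prod⁻¹ * Δ ^ (l.length : ℤ))) : LeftDvd P d (y⁻¹ * Δ) := by
  have hh := invL_head (Δ := Δ) l
  rw [Option.mem_def] at hy
  rw [hy, Option.map_some] at hh
  have hp := invL_prod (Δ := Δ) l
  have hch := invL_chain C l hs hc
  have hcj := invL_conj C l hs
  cases hl : invL Δ l with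
  | nil => rw [hl] at hh; simp at hh
  | cons a m =>
    rw [hl] at hh hp hch hcj
    simp only [List.head?_cons, Option.some.injEq] at hh
    rw [← hh]
    exact head_aux m a (fun s h => C.c1 _ (hcj s h)) hch d (by rw [hp]; exact h2) h1

theorem Core.swap (C : Core P Δ) {a : G} (k : ℤ) : Δ ^ k * a ∈ P ↔ a * Δ ^ k ∈ P := by
  rw [← C.conj_iff (a := Δ ^ k * a) k]
  have : Δ ^ (-k) * (Δ ^ k * a) * Δ ^ k = a * Δ ^ k := by group
  rw [this]

/-- `Δ^k` divides `z`. -/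
def DD (P : Submonoid G) (Δ : G) (k : ℤ) (z : G) : Prop := Δ ^ (-k) * z ∈ P

theorem Core.DD_mul (C : Core P Δ) {j k : ℤ} {a b : G} (ha : DD P Δ j a) (hb : DD P Δ k b) :
    DD P Δ (j + k) (a * b) := by
  have := P.mul_mem (C.conj ha k) hb
  unfold DD
  convert this using 1
  group

theorem DD_zero {a : G} : DD P Δ 0 a ↔ a ∈ P := by simp [DD]

theorem DD_zpow (k : ℤ) : DD P Δ k (Δ ^ k) := by
  unfold DD
  convert P.one_mem using 1
  group

theorem Core.DD_mono (C : Core P Δ) {j k : ℤ} {a : G} (h : j ≤ k) (hk : DD P Δ k a) :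
    DD P Δ j a := by
  obtain ⟨m, rfl⟩ := Int.le.dest h
  have := P.mul_mem (P.pow_mem C.Δpos m) hk
  unfold DD
  convert this using 1
  rw [← zpow_natCast]
  group

theorem Core.DD_pow (C : Core P Δ) {j : ℤ} {a : G} (ha : DD P Δ j a) (m : ℕ) :
    DD P Δ (m * j) (a ^ m) := by
  induction m with
  | zero => simp [DD]
  | succ m ih =>
    have := C.DD_mul ih ha
    rw [pow_succ]
    convert this using 1
    push_cast
    ring

theorem Core.DD_inv_list (C : Core P Δ) (l : List G) (hs : ∀ s ∈ l, DD P Δ (-1) s⁻¹) :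
    DD P Δ (-(l.length : ℤ)) l.prod⁻¹ := by
  induction l with
  | nil => simp [DD]
  | cons x l ih =>
    have := C.DD_mul (ih fun s h => hs s (List.mem_cons_of_mem _ h)) (hs x (by simp))
    rw [List.prod_cons, mul_inv_rev]
    convert this using 1
    rw [List.length_cons]
    push_cast
    ring

theorem Core.DD_simple (C : Core P Δ) {s : G} (h : Simple P Δ s) : DD P Δ (-1) s⁻¹ := by
  have := (C.swap (a := s⁻¹) 1).2 (by simpa [LeftDvd] using h.2)
  simpa [DD] using this

/-- Upper bound for the power of `Δ` dividing the inverse. -/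
theorem Core.inv_bound (C : Core P Δ) (l : List G) (hs : ∀ s ∈ l, Simple P Δ s ∧ s ≠ 1)
    (hΔ : Δ⁻¹ ∉ P) (hc : List.IsChain (WW P Δ) l) (k : ℤ) (hk : DD P Δ k l.prod⁻¹) :
    k ≤ -(l.length : ℤ) := by
  by_contra hlt
  push Not at hlt
  have h1 := C.DD_mono (Int.add_one_le_iff.2 hlt) hk
  cases hl : l.getLast? with
  | none =>
    rw [List.getLast?_eq_none_iff] at hl
    subst hl
    apply hΔ
    simpa [DD] using h1
  | some y =>
    have hy : y ∈ l := List.mem_of_getLast? hl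
    have := C.last l (fun s h => (hs s h).1) hc Δ y hl (by simp [LeftDvd, P.one_mem]) (by
      unfold LeftDvd
      unfold DD at h1
      rw [C.swap] at h1
      have := C.conj h1 1
      convert this using 1
      group)
    apply (hs y hy).2
    apply C.anti _ (hs y hy).1.1
    have := C.c2 _ this
    convert this using 1
    group

theorem Core.fwd_bound (C : Core P Δ) (l : List G) (hs : ∀ s ∈ l, Simple P Δ s ∧ s ≠ Δ)
    (hΔ : Δ⁻¹ ∉ P) (hc : List.IsChain (WW P Δ) l) (k : ℤ) (hk : DD P Δ k l.prod) :
    k ≤ 0 := by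
  by_contra hlt
  push Not at hlt
  have h1 : DD P Δ 1 l.prod := C.DD_mono (by omega) hk
  cases l with
  | nil => apply hΔ; simpa [DD] using h1
  | cons a l =>
    have := head_aux l a (fun s h => C.c1 _ (hs s h).1.1) hc Δ (by simpa [DD, LeftDvd] using h1)
      (by simp [LeftDvd, P.one_mem])
    have ha := hs a (by simp)
    apply ha.2
    have := C.anti _ ha.1.2 (by simpa [LeftDvd] using this)
    rw [inv_mul_eq_one] at this
    exact this

theorem Core.conj_bound (C : Core P Δ) (hD : ∀ z : G, ∃ k, DD P Δ k z) {x z : G} {p q : ℤ}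
    (hx : ∀ m : ℕ, ∀ k, DD P Δ k (x ^ m) → k ≤ m * p) (hxz : IsConj x z) (hz : DD P Δ q z) :
    q ≤ p := by
  rw [isConj_comm, isConj_iff] at hxz
  obtain ⟨g, hg⟩ := hxz
  obtain ⟨a, ha⟩ := hD g
  obtain ⟨b, hb⟩ := hD g⁻¹
  have key : ∀ m : ℕ, a + m * q + b ≤ m * p := fun m => by
    apply hx
    rw [← hg, conj_pow]
    exact C.DD_mul (C.DD_mul ha (C.DD_pow hz m)) hb
  by_contra hlt
  push Not at hlt
  have := key ((a + b).natAbs + 1)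
  push_cast at this
  have h2 : -|a + b| ≤ a + b := neg_abs_le _
  nlinarith [abs_nonneg (a + b)]

/-- The normal form list of the powers of a rigid element. -/
def powL (Δ : G) (p : ℤ) (l : List G) : ℕ → List G
  | 0 => []
  | m + 1 => (powL Δ p l m).map (fun s => Δ ^ (-p) * s * Δ ^ p) ++ l

theorem conj_list_prod (p : ℤ) (l : List G) :
    (l.map (fun s => Δ ^ (-p) * s * Δ ^ p)).prod = Δ ^ (-p) * l.prod * Δ ^ p := by
  induction l with
  | nil => simp
  | cons a l ih => rw [List.map_cons, List.prod_cons, ih, List.prod_cons]; group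

theorem powL_prod (p : ℤ) (l : List G) (m : ℕ) :
    (Δ ^ p * l.prod) ^ m = Δ ^ (m * p) * (powL Δ p l m).prod := by
  induction m with
  | zero => simp [powL]
  | succ m ih =>
    rw [pow_succ, ih, powL, List.prod_append, conj_list_prod]
    push_cast
    group

theorem powL_length (p : ℤ) (l : List G) (m : ℕ) :
    (powL Δ p l m).length = m * l.length := by
  induction m with
  | zero => simp [powL]
  | succ m ih => simp [powL, ih]; ring

theorem Core.Simple_conj (C : Core P Δ) {s : G} (h : Simple P Δ s) (p : ℤ) :
    Simple P Δ (Δ ^ (-p) * s * Δ ^ p) := by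
  refine ⟨C.conj h.1 p, ?_⟩
  have := (C.lconj p).2 h.2
  convert this using 1
  group

theorem powL_simple (C : Core P Δ) (p : ℤ) (l : List G)
    (hs : ∀ s ∈ l, Simple P Δ s ∧ s ≠ 1 ∧ s ≠ Δ) (m : ℕ) :
    ∀ s ∈ powL Δ p l m, Simple P Δ s ∧ s ≠ 1 ∧ s ≠ Δ := by
  induction m with
  | zero => simp [powL]
  | succ m ih =>
    intro s h
    rw [powL, List.mem_append, List.mem_map] at h
    rcases h with ⟨a, ha, rfl⟩ | h
    · obtain ⟨h1, h2, h3⟩ := ih a ha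
      refine ⟨C.Simple_conj h1 p, fun h => h2 ?_, fun h => h3 ?_⟩
      · have : a = Δ ^ p * (Δ ^ (-p) * a * Δ ^ p) * Δ ^ (-p) := by group
        rw [this, h]; group
      · have : a = Δ ^ p * (Δ ^ (-p) * a * Δ ^ p) * Δ ^ (-p) := by group
        rw [this, h]; group
    · exact hs s h

theorem powL_chain (C : Core P Δ) (p : ℤ) (l : List G) (hl : l ≠ [])
    (hc : List.IsChain (WW P Δ) l)
    (hr : ∀ a ∈ l.getLast?, ∀ b ∈ l.head?, WW P Δ a (Δ ^ p * b * Δ ^ (-p))) (m : ℕ) :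
    List.IsChain (WW P Δ) (powL Δ p l m) := by
  induction m with
  | zero => simp [powL]
  | succ m ih =>
    rw [powL, List.isChain_append]
    refine ⟨?_, hc, ?_⟩
    · rw [List.isChain_map]
      exact ih.imp fun a b h => C.WW_conj h p
    · intro a ha b hb
      cases m with
      | zero => simp [powL] at ha
      | succ m =>
        have hlast : (powL Δ p l (m + 1)).getLast? = l.getLast? := by
          rw [powL, List.getLast?_append]
          cases h : l.getLast? with
          | none => rw [List.getLast?_eq_none_iff] at h; exact absurd h hl
          | some y => simp
        rw [List.getLast?_map, hlast] at ha
        simp only [Option.mem_def, Option.map_eq_some_iff] at ha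
        obtain ⟨y, hy, rfl⟩ := ha
        have := C.WW_conj (hr y hy b hb) p
        convert this using 1
        group

end core

section op

open MulOpposite

variable {G : Type*} [Group G] {P : Submonoid G} {Δ : G}

theorem op_list (l : List G) : ((l.map op).reverse).prod = op l.prod := by
  rw [MulOpposite.op_list_prod]

/-- Right-weightedness. -/
def WR (P : Submonoid G) (Δ a b : G) : Prop :=
  ∀ d, RightDvd P d (a * b) → RightDvd P d Δ → RightDvd P d b

theorem ldvd_op (a b : Gᵐᵒᵖ) : LeftDvd P.op a b ↔ RightDvd P (unop a) (unop b) := by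
  simp [LeftDvd, RightDvd, Submonoid.mem_op]

theorem WW_op {a b : G} (h : WR P Δ a b) : WW P.op (op Δ) (op b) (op a) := by
  intro d h1 h2
  rw [ldvd_op] at *
  exact h _ h1 h2

theorem chain_op {l : List G} (h : List.IsChain (WR P Δ) l) :
    List.IsChain (WW P.op (op Δ)) (l.map op).reverse := by
  rw [List.isChain_reverse, List.isChain_map]
  exact h.imp fun a b h => WW_op h

theorem simple_op {s : G} (h : s ∈ P) (h2 : RightDvd P s Δ) : Simple P.op (op Δ) (op s) :=
  ⟨h, by rw [ldvd_op]; exact h2⟩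

theorem Core.opp (C : Core P Δ)
    (hl : ∀ a b : G, ∃ m, RightDvd P a m ∧ RightDvd P b m ∧
      ∀ c, RightDvd P a c → RightDvd P b c → RightDvd P m c) : Core P.op (op Δ) where
  anti a h1 h2 := by
    apply MulOpposite.unop_injective
    exact C.anti _ h1 h2
  Δpos := C.Δpos
  c1 a h := by
    rw [Submonoid.mem_op] at *
    convert C.c2 _ h using 1
    simp [mul_assoc]
  c2 a h := by
    rw [Submonoid.mem_op] at *
    convert C.c1 _ h using 1
    simp [mul_assoc]
  lcm a b := by
    obtain ⟨m, h1, h2, h3⟩ := hl (unop a) (unop b)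
    refine ⟨MulOpposite.op m, ?_, ?_, ?_⟩
    · rw [ldvd_op]; exact h1
    · rw [ldvd_op]; exact h2
    · intro c hc1 hc2
      rw [ldvd_op] at *
      exact h3 _ hc1 hc2

theorem Core.headR (C : Core P.op (op Δ)) (l : List G) (hs : ∀ s ∈ l, s ∈ P ∧ RightDvd P s Δ)
    (hc : List.IsChain (WR P Δ) l) (d y : G) (hy : y ∈ l.getLast?)
    (h1 : RightDvd P d l.prod) (h2 : RightDvd P d Δ) : RightDvd P d y := by
  have hch := chain_op hc
  have hp := op_list l
  have hss : ∀ s ∈ (l.map MulOpposite.op).reverse, s ∈ P.op := by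
    intro s h
    rw [List.mem_reverse, List.mem_map] at h
    obtain ⟨a, ha, rfl⟩ := h
    exact (hs a ha).1
  have hh : (l.map MulOpposite.op).reverse.head? = some (MulOpposite.op y) := by
    rw [Option.mem_def] at hy
    rw [List.head?_reverse, List.getLast?_map, hy]
    rfl
  cases hl : (l.map MulOpposite.op).reverse with
  | nil => rw [hl] at hh; simp at hh
  | cons a m =>
    rw [hl] at hh hp hch hss
    simp only [List.head?_cons, Option.some.injEq] at hh
    have := head_aux m a (fun s h => C.c1 _ (hss s h)) hch (MulOpposite.op d)
      (by rw [hp, ldvd_op]; exact h1) (by rw [ldvd_op]; exact h2)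
    rw [ldvd_op, hh] at this
    exact this

theorem Core.lastR (C : Core P.op (op Δ)) (l : List G) (hs : ∀ s ∈ l, s ∈ P ∧ RightDvd P s Δ)
    (hc : List.IsChain (WR P Δ) l) (d y : G) (hy : y ∈ l.head?)
    (h1 : RightDvd P d Δ) (h2 : RightDvd P d (Δ ^ (l.length : ℤ) * l.prod⁻¹)) :
    RightDvd P d (Δ * y⁻¹) := by
  have := C.last (l.map MulOpposite.op).reverse (by
      intro s h
      rw [List.mem_reverse, List.mem_map] at h
      obtain ⟨a, ha, rfl⟩ := h
      exact simple_op (hs a ha).1 (hs a ha).2) (chain_op hc) (MulOpposite.op d)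
    (MulOpposite.op y) (by
      rw [Option.mem_def] at hy
      rw [List.getLast?_reverse, List.head?_map, hy]
      rfl) (by rw [ldvd_op]; exact h1) (by
      rw [op_list, ldvd_op]
      simpa using h2)
  rw [ldvd_op] at this
  simpa using this

end op

namespace GarsideGroup

variable {G : Type*} [Group G] (𝒢 : GarsideGroup G)

theorem Δ_ne : 𝒢.Δ ≠ 1 := by
  intro h
  have h0 : ∀ p : ℤ, IsLeftNF 𝒢.pos 𝒢.Δ 𝒢.gcdL p [] 1 := fun p =>
    ⟨by simp [h], by simp, List.IsChain.nil⟩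
  have := (𝒢.lnf_unique 1 0 1 [] [] (h0 0) (h0 1)).1
  omega

theorem Δ_inv : 𝒢.Δ⁻¹ ∉ 𝒢.pos := fun h => 𝒢.Δ_ne (𝒢.pos_antisymm _ 𝒢.Δ_pos h)

theorem simple_right {s : G} (h : Simple 𝒢.pos 𝒢.Δ s) : RightDvd 𝒢.pos s 𝒢.Δ :=
  ((𝒢.divisors_Δ s).1 h).2

theorem simple_c1 {s : G} (h : Simple 𝒢.pos 𝒢.Δ s) : 𝒢.Δ⁻¹ * s * 𝒢.Δ ∈ 𝒢.pos := by
  have ht : s⁻¹ * 𝒢.Δ ∈ 𝒢.pos := h.2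
  have h1 : s⁻¹ * 𝒢.Δ ∈ 𝒢.pos ∧ RightDvd 𝒢.pos (s⁻¹ * 𝒢.Δ) 𝒢.Δ := by
    refine ⟨ht, ?_⟩
    unfold RightDvd
    simpa using h.1
  have h2 := ((𝒢.divisors_Δ _).2 h1).2
  unfold LeftDvd at h2
  convert h2 using 1
  group

theorem simple_c2 {s : G} (h : Simple 𝒢.pos 𝒢.Δ s) : 𝒢.Δ * s * 𝒢.Δ⁻¹ ∈ 𝒢.pos := by
  have ht : 𝒢.Δ * s⁻¹ ∈ 𝒢.pos := 𝒢.simple_right h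
  have h1 : 𝒢.Δ * s⁻¹ ∈ 𝒢.pos ∧ LeftDvd 𝒢.pos (𝒢.Δ * s⁻¹) 𝒢.Δ := by
    refine ⟨ht, ?_⟩
    unfold LeftDvd
    simpa using h.1
  have h2 := ((𝒢.divisors_Δ _).1 h1).2
  unfold RightDvd at h2
  convert h2 using 1
  group

theorem ww_of {a b : G} (h : 𝒢.gcdL (a * b) 𝒢.Δ = a) : WW 𝒢.pos 𝒢.Δ a b := by
  intro d h1 h2
  rw [← h]
  exact 𝒢.dvd_gcdL _ _ _ h1 h2

theorem wr_of {a b : G} (h : 𝒢.gcdR (a * b) 𝒢.Δ = b) : WR 𝒢.pos 𝒢.Δ a b := by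
  intro d h1 h2
  rw [← h]
  exact 𝒢.dvd_gcdR _ _ _ h1 h2

theorem chainL {p : ℤ} {l : List G} {x : G} (h : IsLeftNF 𝒢.pos 𝒢.Δ 𝒢.gcdL p l x) :
    List.IsChain (WW 𝒢.pos 𝒢.Δ) l := List.IsChain.imp (fun _ _ => 𝒢.ww_of) h.2.2

theorem chainR {p : ℤ} {l : List G} {x : G} (h : IsRightNF 𝒢.pos 𝒢.Δ 𝒢.gcdR p l x) :
    List.IsChain (WR 𝒢.pos 𝒢.Δ) l := List.IsChain.imp (fun _ _ => 𝒢.wr_of) h.2.2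

theorem pos_gen {a : G} (ha : a ∈ 𝒢.pos) : ∃ (k : ℕ) (l : List G),
    (∀ s ∈ l, Simple 𝒢.pos 𝒢.Δ s) ∧ a = 𝒢.Δ ^ k * l.prod := by
  obtain ⟨⟨p, l⟩, h⟩ := 𝒢.lnf_exists a
  have hc := 𝒢.chainL h
  obtain ⟨h1, h2, h3⟩ := h
  simp only at h1 h2 h3 hc
  obtain ⟨m, rfl | rfl⟩ := p.eq_nat_or_neg
  · exact ⟨m, l, fun s h => (h2 s h).1, by rw [h1, zpow_natCast]⟩
  · cases m with
    | zero => exact ⟨0, l, fun s h => (h2 s h).1, by rw [h1]; simp⟩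
    | succ m =>
      exfalso
      have hd : 𝒢.Δ⁻¹ * l.prod ∈ 𝒢.pos := by
        have := 𝒢.pos.mul_mem (𝒢.pos.pow_mem 𝒢.Δ_pos m) ha
        convert this using 1
        rw [h1, ← zpow_natCast]
        push_cast
        group
      cases l with
      | nil => exact 𝒢.Δ_inv (by simpa using hd)
      | cons b l =>
        have := head_aux l b (fun s h => 𝒢.simple_c1 (h2 s h).1) hc 𝒢.Δ hd
          (by simp [LeftDvd, 𝒢.pos.one_mem])
        have hb := h2 b (by simp)
        apply hb.2.2
        have := 𝒢.pos_antisymm _ hb.1.2 (by simpa [LeftDvd] using this)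
        rw [inv_mul_eq_one] at this
        exact this

theorem core : Core 𝒢.pos 𝒢.Δ where
  anti := 𝒢.pos_antisymm
  Δpos := 𝒢.Δ_pos
  c1 a ha := by
    obtain ⟨k, l, hl, rfl⟩ := 𝒢.pos_gen ha
    have h : 𝒢.Δ ^ k * l.prod ∈ 𝒢.pos.comap (MulAut.conj 𝒢.Δ⁻¹).toMonoidHom := by
      refine Submonoid.mul_mem _ (Submonoid.pow_mem _ ?_ k) (Submonoid.list_prod_mem _ ?_)
      · simpa using 𝒢.Δ_pos
      · intro s hs
        simpa using 𝒢.simple_c1 (hl s hs)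
    simpa using h
  c2 a ha := by
    obtain ⟨k, l, hl, rfl⟩ := 𝒢.pos_gen ha
    have h : 𝒢.Δ ^ k * l.prod ∈ 𝒢.pos.comap (MulAut.conj 𝒢.Δ).toMonoidHom := by
      refine Submonoid.mul_mem _ (Submonoid.pow_mem _ ?_ k) (Submonoid.list_prod_mem _ ?_)
      · simpa using 𝒢.Δ_pos
      · intro s hs
        simpa using 𝒢.simple_c2 (hl s hs)
    simpa using h
  lcm a b := ⟨𝒢.lcmL a b, 𝒢.dvd_lcmL_left a b, 𝒢.dvd_lcmL_right a b, 𝒢.lcmL_dvd a b⟩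

theorem coreR : Core 𝒢.pos.op (MulOpposite.op 𝒢.Δ) :=
  𝒢.core.opp fun a b =>
    ⟨𝒢.lcmR a b, 𝒢.dvd_lcmR_left a b, 𝒢.dvd_lcmR_right a b, 𝒢.lcmR_dvd a b⟩

theorem lnf_spec (x : G) : IsLeftNF 𝒢.pos 𝒢.Δ 𝒢.gcdL (𝒢.lnf x).1 (𝒢.lnf x).2 x :=
  Classical.choose_spec (𝒢.lnf_exists x)

theorem rnf_spec (x : G) : IsRightNF 𝒢.pos 𝒢.Δ 𝒢.gcdR (𝒢.rnf x).1 (𝒢.rnf x).2 x :=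
  Classical.choose_spec (𝒢.rnf_exists x)

theorem DD_inf (z : G) : DD 𝒢.pos 𝒢.Δ (𝒢.inf z) z := by
  have h := (𝒢.lnf_spec z)
  have := 𝒢.core.DD_mul (DD_zpow (P := 𝒢.pos) (Δ := 𝒢.Δ) (𝒢.lnf z).1)
    (DD_zero.2 (𝒢.pos.list_prod_mem fun s hs => (h.2.1 s hs).1.1))
  rw [← h.1, add_zero] at this
  exact this

theorem DD_le {k : ℤ} {z : G} (hk : DD 𝒢.pos 𝒢.Δ k z) : k ≤ 𝒢.inf z := by
  have h := 𝒢.lnf_spec z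
  have h2 : DD 𝒢.pos 𝒢.Δ (-𝒢.inf z + k) (𝒢.lnf z).2.prod := by
    have := 𝒢.core.DD_mul (DD_zpow (P := 𝒢.pos) (Δ := 𝒢.Δ) (-𝒢.inf z)) hk
    convert this using 1
    nth_rw 3 [h.1]
    unfold GarsideGroup.inf
    group
  have := 𝒢.core.fwd_bound _ (fun s hs => ⟨(h.2.1 s hs).1, (h.2.1 s hs).2.2⟩) 𝒢.Δ_inv
    (𝒢.chainL h) _ h2
  omega

theorem DD_inv (z : G) : DD 𝒢.pos 𝒢.Δ (-(𝒢.inf z + 𝒢.len z)) z⁻¹ := by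
  have h := 𝒢.lnf_spec z
  have := 𝒢.core.DD_mul
    (𝒢.core.DD_inv_list _ fun s hs => 𝒢.core.DD_simple (h.2.1 s hs).1)
    (DD_zpow (P := 𝒢.pos) (Δ := 𝒢.Δ) (-𝒢.inf z))
  convert this using 1
  · unfold GarsideGroup.len; ring
  · nth_rw 1 [h.1]
    unfold GarsideGroup.inf
    group

theorem DD_inv_le {k : ℤ} {z : G} (hk : DD 𝒢.pos 𝒢.Δ k z⁻¹) : k ≤ -(𝒢.inf z + 𝒢.len z) := by
  have h := 𝒢.lnf_spec z
  have h2 : DD 𝒢.pos 𝒢.Δ (k + 𝒢.inf z) (𝒢.lnf z).2.prod⁻¹ := by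
    have := 𝒢.core.DD_mul hk (DD_zpow (P := 𝒢.pos) (Δ := 𝒢.Δ) (𝒢.inf z))
    convert this using 1
    nth_rw 2 [h.1]
    unfold GarsideGroup.inf
    group
  have := 𝒢.core.inv_bound _ (fun s hs => ⟨(h.2.1 s hs).1, (h.2.1 s hs).2.1⟩) 𝒢.Δ_inv
    (𝒢.chainL h) _ h2
  unfold GarsideGroup.len
  omega

theorem rinf (z : G) : (𝒢.rnf z).1 = 𝒢.inf z ∧ (𝒢.rnf z).2.length = 𝒢.len z := by
  have := 𝒢.lnf_rnf_agree z _ _ _ _ (𝒢.lnf_spec z) (𝒢.rnf_spec z)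
  exact ⟨this.1.symm, this.2.symm⟩

theorem RightDvd.trans' {P : Submonoid G} {a b c : G} (h : RightDvd P a b)
    (h' : RightDvd P b c) : RightDvd P a c := by
  have := P.mul_mem h' h
  unfold RightDvd
  convert this using 1
  group

theorem rconj {a b : G} (k : ℤ) : RightDvd 𝒢.pos a (𝒢.Δ ^ (-k) * b * 𝒢.Δ ^ k) ↔
    RightDvd 𝒢.pos (𝒢.Δ ^ k * a * 𝒢.Δ ^ (-k)) b := by
  unfold RightDvd
  rw [← 𝒢.core.conj_iff (a := b * (𝒢.Δ ^ k * a * 𝒢.Δ ^ (-k))⁻¹) k]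
  have : 𝒢.Δ ^ (-k) * (b * (𝒢.Δ ^ k * a * 𝒢.Δ ^ (-k))⁻¹) * 𝒢.Δ ^ k =
    𝒢.Δ ^ (-k) * b * 𝒢.Δ ^ k * a⁻¹ := by group
  rw [this]

theorem iotaR_spec (z d : G) : RightDvd 𝒢.pos d (𝒢.iotaR z) ↔
    RightDvd 𝒢.pos d (𝒢.Δ ^ (-𝒢.inf z) * z) ∧ RightDvd 𝒢.pos d 𝒢.Δ := by
  have h := 𝒢.rnf_spec z
  have hc := 𝒢.chainR h
  obtain ⟨h1, h2, -⟩ := h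
  have hq := (𝒢.rinf z).1
  have hz : 𝒢.Δ ^ (-𝒢.inf z) * z = 𝒢.Δ ^ (-𝒢.inf z) * (𝒢.rnf z).2.prod * 𝒢.Δ ^ (𝒢.inf z) := by
    nth_rw 2 [h1]
    rw [hq]
    group
  have hΔ : 𝒢.Δ = 𝒢.Δ ^ (-𝒢.inf z) * 𝒢.Δ * 𝒢.Δ ^ (𝒢.inf z) := by group
  have hΔ' : RightDvd 𝒢.pos d 𝒢.Δ ↔
      RightDvd 𝒢.pos (𝒢.Δ ^ 𝒢.inf z * d * 𝒢.Δ ^ (-𝒢.inf z)) 𝒢.Δ := by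
    rw [← 𝒢.rconj, ← hΔ]
  unfold iotaR tau
  rw [hq, hz, hΔ', 𝒢.rconj, 𝒢.rconj]
  generalize 𝒢.Δ ^ 𝒢.inf z * d * 𝒢.Δ ^ (-𝒢.inf z) = e
  generalize (𝒢.rnf z).2 = l at *
  cases hl : l.getLast? with
  | none =>
    rw [List.getLast?_eq_none_iff] at hl
    subst hl
    simp only [Option.getD_none, List.prod_nil]
    refine ⟨fun h => ⟨h, RightDvd.trans' h ?_⟩, fun h => h.1⟩
    simpa [RightDvd] using 𝒢.Δ_pos
  | some y =>
    simp only [Option.getD_some]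
    have hy := h2 y (List.mem_of_getLast? hl)
    refine ⟨fun h => ⟨RightDvd.trans' h ?_, RightDvd.trans' h (𝒢.simple_right hy.1)⟩,
      fun h => ?_⟩
    · obtain ⟨l', rfl⟩ := List.getLast?_eq_some_iff.1 hl
      rw [List.prod_append, List.prod_singleton]
      unfold RightDvd
      rw [mul_inv_cancel_right]
      exact 𝒢.pos.list_prod_mem fun s hs => (h2 s (by simp [hs])).1.1
    · exact 𝒢.coreR.headR l (fun s hs => ⟨(h2 s hs).1.1, 𝒢.simple_right (h2 s hs).1⟩) hc e y hl
        h.1 h.2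

theorem iotaL_spec (z d : G) (hd : LeftDvd 𝒢.pos d (𝒢.iotaL z)) :
    LeftDvd 𝒢.pos d (z * 𝒢.Δ ^ (-𝒢.inf z)) := by
  obtain ⟨h1, h2, -⟩ := 𝒢.lnf_spec z
  refine hd.trans' ?_
  have hz : z * 𝒢.Δ ^ (-𝒢.inf z) =
      𝒢.Δ ^ (-(-𝒢.inf z)) * (𝒢.lnf z).2.prod * 𝒢.Δ ^ (-𝒢.inf z) := by
    nth_rw 1 [h1]
    unfold GarsideGroup.inf
    group
  rw [hz]
  unfold iotaL tau
  change LeftDvd 𝒢.pos (𝒢.Δ ^ (-(-𝒢.inf z)) * _ * 𝒢.Δ ^ (-𝒢.inf z)) _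
  rw [𝒢.core.lconj]
  generalize (𝒢.lnf z).2 = l at *
  cases l with
  | nil => simp [LeftDvd, 𝒢.pos.one_mem]
  | cons a l =>
    unfold LeftDvd
    simp only [List.headD_cons, List.prod_cons, inv_mul_cancel_left]
    exact 𝒢.pos.list_prod_mem fun s hs => (h2 s (by simp [hs])).1.1

/-- `z` is a conjugate of `x` with infimum `p` and supremum `N`. -/
def Good (x : G) (p N : ℤ) (z : G) : Prop :=
  IsConj x z ∧ 𝒢.inf z = p ∧ 𝒢.inf z⁻¹ = -N

theorem rigid_bound {x : G} (hx : 𝒢.LeftRigid x) (m : ℕ) (k : ℤ) :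
    (DD 𝒢.pos 𝒢.Δ k (x ^ m) → k ≤ m * 𝒢.inf x) ∧
    (DD 𝒢.pos 𝒢.Δ k ((x⁻¹) ^ m) → k ≤ m * (-(𝒢.inf x + 𝒢.len x))) := by
  obtain ⟨hne, hrig⟩ := hx
  have hn := 𝒢.lnf_spec x
  have hpr := powL_prod (Δ := 𝒢.Δ) (𝒢.lnf x).1 (𝒢.lnf x).2 m
  rw [← hn.1] at hpr
  have hlen := powL_length (Δ := 𝒢.Δ) (𝒢.lnf x).1 (𝒢.lnf x).2 m
  have hsim := powL_simple 𝒢.core (𝒢.lnf x).1 (𝒢.lnf x).2 hn.2.1 m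
  have hch := powL_chain 𝒢.core (𝒢.lnf x).1 (𝒢.lnf x).2 hne (𝒢.chainL hn) (by
    have := 𝒢.chainL hrig
    rw [List.isChain_append] at this
    intro a ha b hb
    have h3 := this.2.2 a ha (𝒢.iotaL x) (by simp)
    unfold iotaL tau at h3
    rw [List.headD_eq_head?_getD, Option.mem_def.1 hb] at h3
    simpa using h3) m
  have hp : (𝒢.lnf x).1 = 𝒢.inf x := rfl
  have hl : (𝒢.lnf x).2.length = 𝒢.len x := rfl
  rw [hp] at hpr hlen hsim hch
  rw [hl] at hlen
  generalize powL 𝒢.Δ (𝒢.inf x) (𝒢.lnf x).2 m = L at *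
  constructor
  · intro hk
    rw [hpr] at hk
    have h2 := 𝒢.core.DD_mul (DD_zpow (P := 𝒢.pos) (Δ := 𝒢.Δ) (-(m * 𝒢.inf x))) hk
    have h3 := 𝒢.core.fwd_bound L (fun s hs => ⟨(hsim s hs).1, (hsim s hs).2.2⟩) 𝒢.Δ_inv hch
      (-(m * 𝒢.inf x) + k) (by convert h2 using 1; group)
    linarith
  · intro hk
    rw [inv_pow, hpr] at hk
    have h2 := 𝒢.core.DD_mul hk (DD_zpow (P := 𝒢.pos) (Δ := 𝒢.Δ) (m * 𝒢.inf x))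
    have h3 := 𝒢.core.inv_bound L (fun s hs => ⟨(hsim s hs).1, (hsim s hs).2.1⟩) 𝒢.Δ_inv hch
      (k + m * 𝒢.inf x) (by convert h2 using 1; group)
    rw [hlen] at h3
    push_cast at h3
    linarith

theorem isConj_inv {a b : G} (h : IsConj a b) : IsConj a⁻¹ b⁻¹ := by
  rw [isConj_iff] at *
  obtain ⟨c, rfl⟩ := h
  exact ⟨c, by group⟩

theorem upper {x : G} (hx : 𝒢.LeftRigid x) {z : G} (hz : IsConj x z) :
    𝒢.inf z ≤ 𝒢.inf x ∧ 𝒢.inf z⁻¹ ≤ -(𝒢.inf x + 𝒢.len x) :=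
  ⟨𝒢.core.conj_bound (fun z => ⟨_, 𝒢.DD_inf z⟩) (fun m k => (𝒢.rigid_bound hx m k).1) hz
    (𝒢.DD_inf z),
   𝒢.core.conj_bound (fun z => ⟨_, 𝒢.DD_inf z⟩) (fun m k => (𝒢.rigid_bound hx m k).2)
    (isConj_inv hz) (𝒢.DD_inf _)⟩

theorem good_of {x : G} (hx : 𝒢.LeftRigid x) {z : G} (hz : IsConj x z)
    (h1 : DD 𝒢.pos 𝒢.Δ (𝒢.inf x) z) (h2 : DD 𝒢.pos 𝒢.Δ (-(𝒢.inf x + 𝒢.len x)) z⁻¹) :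
    𝒢.Good x (𝒢.inf x) (𝒢.inf x + 𝒢.len x) z :=
  ⟨hz, le_antisymm (𝒢.upper hx hz).1 (𝒢.DD_le h1), le_antisymm (𝒢.upper hx hz).2 (𝒢.DD_le h2)⟩

theorem good_self {x : G} (hx : 𝒢.LeftRigid x) :
    𝒢.Good x (𝒢.inf x) (𝒢.inf x + 𝒢.len x) x :=
  𝒢.good_of hx (IsConj.refl x) (𝒢.DD_inf x) (𝒢.DD_inv x)

theorem good_SSS {x : G} (hx : 𝒢.LeftRigid x) {z : G} (hz : z ∈ 𝒢.SSS x) :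
    𝒢.Good x (𝒢.inf x) (𝒢.inf x + 𝒢.len x) z := by
  obtain ⟨hc, hm⟩ := hz
  have h1 := hm x (IsConj.refl x)
  have h2 := 𝒢.upper hx hc
  have h3 := 𝒢.DD_le (𝒢.DD_inv z)
  refine ⟨hc, ?_, ?_⟩ <;> omega

theorem good_len {x : G} {p N : ℤ} {z : G} (h : 𝒢.Good x p N z) : p + 𝒢.len z = N := by
  have h1 := 𝒢.DD_le (𝒢.DD_inv z)
  have h2 := 𝒢.DD_inv_le (𝒢.DD_inf z⁻¹)
  obtain ⟨-, h3, h4⟩ := h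
  omega

theorem iotaR_self (z : G) : RightDvd 𝒢.pos (𝒢.iotaR z) (𝒢.Δ ^ (-𝒢.inf z) * z) ∧
    RightDvd 𝒢.pos (𝒢.iotaR z) 𝒢.Δ :=
  (𝒢.iotaR_spec z _).1 (by simp [RightDvd, 𝒢.pos.one_mem])

theorem iotaR_pos (z : G) : 𝒢.iotaR z ∈ 𝒢.pos := by
  have := (𝒢.iotaR_spec z 1).2 ⟨by simpa [RightDvd, DD] using 𝒢.DD_inf z,
    by simpa [RightDvd] using 𝒢.Δ_pos⟩
  simpa [RightDvd] using this

theorem iotaR_simple (z : G) : Simple 𝒢.pos 𝒢.Δ (𝒢.iotaR z) :=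
  (𝒢.divisors_Δ _).2 ⟨𝒢.iotaR_pos z, (𝒢.iotaR_self z).2⟩

theorem transport_pos {v u s : G} (hs : s ∈ 𝒢.pos) (h : s * v * s⁻¹ = u)
    (hi : 𝒢.inf u = 𝒢.inf v) : 𝒢.iotaR u * s * (𝒢.iotaR v)⁻¹ ∈ 𝒢.pos := by
  have key := (𝒢.iotaR_spec u (𝒢.iotaR v * s⁻¹)).2 (by
    obtain ⟨h1, h2⟩ := 𝒢.iotaR_self v
    unfold RightDvd at *
    constructor
    · have := 𝒢.pos.mul_mem (𝒢.core.conj hs (𝒢.inf v)) h1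
      convert this using 1
      rw [hi, ← h]
      group
    · have := 𝒢.pos.mul_mem (𝒢.core.c2 _ hs) h2
      convert this using 1
      group)
  unfold RightDvd at key
  convert key using 1
  group

theorem transport_simple {v u s : G} (hs : Simple 𝒢.pos 𝒢.Δ s) (h : s * v * s⁻¹ = u)
    (hi : 𝒢.inf u = 𝒢.inf v) : Simple 𝒢.pos 𝒢.Δ (𝒢.iotaR u * s * (𝒢.iotaR v)⁻¹) := by
  refine (𝒢.divisors_Δ _).2 ⟨𝒢.transport_pos hs.1 h hi, ?_⟩
  have ha : 𝒢.Δ * s⁻¹ ∈ 𝒢.pos := 𝒢.simple_right hs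
  have key := (𝒢.iotaR_spec v (𝒢.Δ⁻¹ * 𝒢.iotaR u * s)).2 (by
    obtain ⟨h1, h2⟩ := 𝒢.iotaR_self u
    have h3 : (𝒢.iotaR u)⁻¹ * 𝒢.Δ ∈ 𝒢.pos := (𝒢.iotaR_simple u).2
    unfold RightDvd at *
    constructor
    · have := 𝒢.core.c1 _ (𝒢.pos.mul_mem (𝒢.core.conj ha (𝒢.inf u)) h1)
      convert this using 1
      rw [hi, ← h]
      group
    · have := 𝒢.pos.mul_mem ha h3
      convert this using 1
      group)
  unfold RightDvd at *
  have := 𝒢.core.c2 _ key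
  convert this using 1
  group

theorem cR_conj (z : G) : IsConj z (𝒢.cR z) := isConj_iff.2 ⟨_, rfl⟩

theorem good_cR {x : G} (hx : 𝒢.LeftRigid x) {z : G}
    (h : 𝒢.Good x (𝒢.inf x) (𝒢.inf x + 𝒢.len x) z) :
    𝒢.Good x (𝒢.inf x) (𝒢.inf x + 𝒢.len x) (𝒢.cR z) := by
  have hsup := 𝒢.good_len h
  have hl := (𝒢.rinf z)
  have hn := 𝒢.rnf_spec z
  obtain ⟨hc, h1, h2⟩ := h
  refine 𝒢.good_of hx (hc.trans (𝒢.cR_conj z)) ?_ ?_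
  · have h3 := (𝒢.iotaR_self z).1
    have := 𝒢.pos.mul_mem (𝒢.core.conj (𝒢.iotaR_pos z) (𝒢.inf z)) h3
    unfold DD cR
    convert this using 1
    rw [h1]
    group
  · have h4 : 𝒢.iotaR z = 𝒢.Δ ^ (-𝒢.inf z) * (((𝒢.rnf z).2.getLast?).getD 1) * 𝒢.Δ ^ 𝒢.inf z := by
      unfold iotaR tau
      rw [hl.1]
    rw [← hsup, ← h1, ← hl.2]
    obtain ⟨e, hs, -⟩ := hn
    rw [hl.1] at e
    have hι := 𝒢.core.DD_simple (𝒢.iotaR_simple z)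
    unfold cR
    generalize 𝒢.iotaR z = ι at *
    generalize (𝒢.rnf z).2 = l at *
    rcases List.eq_nil_or_concat l with rfl | ⟨l', y, rfl⟩
    · have := DD_zpow (P := 𝒢.pos) (Δ := 𝒢.Δ) (-𝒢.inf z)
      simp only [List.getLast?_nil, Option.getD_none] at h4
      convert this using 1
      · simp
      · rw [h4]
        nth_rw 3 [e]
        simp
    · simp only [List.concat_eq_append, List.getLast?_concat, Option.getD_some] at h4 e hs ⊢
      have := 𝒢.core.DD_mul (𝒢.core.DD_mul (DD_zpow (P := 𝒢.pos) (Δ := 𝒢.Δ) (-𝒢.inf z))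
        (𝒢.core.DD_inv_list l' fun s h => 𝒢.core.DD_simple (hs s (by simp [h])).1)) hι
      convert this using 1
      · simp
        ring
      · rw [List.prod_append, List.prod_singleton] at e
        have e2 : z = l'.prod * 𝒢.Δ ^ 𝒢.inf z * ι := by
          rw [h4]
          nth_rw 1 [e]
          group
        have e3 : (ι * z * ι⁻¹)⁻¹ = (z * ι⁻¹)⁻¹ * ι⁻¹ := by group
        rw [e3]
        congr 1
        nth_rw 1 [e2]
        group

theorem grey_step {v u s : G} (hs : Simple 𝒢.pos 𝒢.Δ s) (hr : 1 < 𝒢.len v)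
    (h : 𝒢.Δ ^ (𝒢.inf v + 𝒢.len v) * v⁻¹ * s⁻¹ ∈ 𝒢.pos) :
    𝒢.Δ ^ (𝒢.inf v + 𝒢.len v) * (𝒢.cR v)⁻¹ * (𝒢.iotaR u * s * (𝒢.iotaR v)⁻¹)⁻¹ ∈ 𝒢.pos := by
  have hl := (𝒢.rinf v)
  have hn := 𝒢.rnf_spec v
  have hch := 𝒢.chainR hn
  have h4 : 𝒢.iotaR v = 𝒢.Δ ^ (-𝒢.inf v) * (((𝒢.rnf v).2.getLast?).getD 1) * 𝒢.Δ ^ 𝒢.inf v := by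
    unfold iotaR tau
    rw [hl.1]
  obtain ⟨e, hsim, -⟩ := hn
  rw [hl.1] at e
  have hιu := 𝒢.core.DD_simple (𝒢.iotaR_simple u)
  rw [← hl.2] at hr h ⊢
  unfold cR
  generalize 𝒢.iotaR v = ι at *
  generalize 𝒢.iotaR u = κ at *
  generalize (𝒢.rnf v).2 = l at *
  cases l with
  | nil => simp at hr
  | cons a l =>
    rcases List.eq_nil_or_concat l with rfl | ⟨l', y, rfl⟩
    · simp at hr
    · simp only [List.concat_eq_append] at *
      have hh := 𝒢.coreR.lastR _ (fun s hs => ⟨(hsim s hs).1.1, 𝒢.simple_right (hsim s hs).1⟩)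
        hch s a (by simp) (𝒢.simple_right hs) (by
          unfold RightDvd
          convert h using 1
          nth_rw 2 [e]
          group)
      have hsa : DD 𝒢.pos 𝒢.Δ (-1) (s * a)⁻¹ := by
        unfold DD
        unfold RightDvd at hh
        convert hh using 1
        group
      have hy : ((a :: (l' ++ [y])).getLast?).getD 1 = y := by
        rw [← List.cons_append, List.getLast?_concat, Option.getD_some]
      rw [hy] at h4
      have := 𝒢.core.DD_mul (𝒢.core.DD_mul (𝒢.core.DD_mul
        (DD_zpow (P := 𝒢.pos) (Δ := 𝒢.Δ) (-𝒢.inf v))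
        (𝒢.core.DD_inv_list l' fun s h => 𝒢.core.DD_simple (hsim s (by simp [h])).1)) hsa) hιu
      unfold DD at this
      rw [List.prod_cons, List.prod_append, List.prod_singleton] at e
      have e2 : v = a * l'.prod * 𝒢.Δ ^ 𝒢.inf v * ι := by
        rw [h4]
        nth_rw 1 [e]
        group
      have e3 : (ι * v * ι⁻¹)⁻¹ * (κ * s * ι⁻¹)⁻¹ = (v * ι⁻¹)⁻¹ * s⁻¹ * κ⁻¹ := by group
      rw [mul_assoc, e3]
      have e4 : (v * ι⁻¹)⁻¹ * s⁻¹ * κ⁻¹ =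
          𝒢.Δ ^ (-𝒢.inf v) * l'.prod⁻¹ * (s * a)⁻¹ * κ⁻¹ := by
        nth_rw 1 [e2]
        group
      rw [e4]
      convert this using 3
      simp only [List.length_cons, List.length_append, List.length_nil]
      push_cast
      ring

theorem iter_main {x : G} (hx : 𝒢.LeftRigid x) {u v s : G}
    (hu : 𝒢.Good x (𝒢.inf x) (𝒢.inf x + 𝒢.len x) u)
    (hv : 𝒢.Good x (𝒢.inf x) (𝒢.inf x + 𝒢.len x) v)
    (hs : Simple 𝒢.pos 𝒢.Δ s) (h : s⁻¹ * u * s = v) (i : ℕ) :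
    𝒢.Good x (𝒢.inf x) (𝒢.inf x + 𝒢.len x) ((𝒢.cR)^[i] u) ∧
    𝒢.Good x (𝒢.inf x) (𝒢.inf x + 𝒢.len x) ((𝒢.cR)^[i] v) ∧
    Simple 𝒢.pos 𝒢.Δ (𝒢.transRIter v i s) ∧
    𝒢.transRIter v i s * (𝒢.cR)^[i] v * (𝒢.transRIter v i s)⁻¹ = (𝒢.cR)^[i] u ∧
    (LeftDvd 𝒢.pos s (𝒢.iotaL u) →
      RightDvd 𝒢.pos (𝒢.transRIter v i s) (𝒢.iotaR ((𝒢.cR)^[i] v))) ∧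
    (1 < 𝒢.len x → LeftDvd 𝒢.pos s (𝒢.iotaL u⁻¹) →
      𝒢.Δ ^ (𝒢.inf x + 𝒢.len x) * ((𝒢.cR)^[i] v)⁻¹ * (𝒢.transRIter v i s)⁻¹ ∈ 𝒢.pos) := by
  induction i with
  | zero =>
    simp only [Function.iterate_zero, id_eq, transRIter]
    refine ⟨hu, hv, hs, by rw [← h]; group, fun hb => ?_, fun _ hg => ?_⟩
    · have h1 := 𝒢.iotaL_spec _ _ hb
      rw [𝒢.iotaR_spec]
      refine ⟨?_, 𝒢.simple_right hs⟩
      unfold LeftDvd at h1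
      unfold RightDvd
      rw [hu.2.1] at h1
      rw [hv.2.1, mul_assoc, 𝒢.core.swap, ← h]
      convert h1 using 1
      group
    · have h1 := 𝒢.iotaL_spec _ _ hg
      unfold LeftDvd at h1
      rw [hu.2.2] at h1
      rw [mul_assoc, 𝒢.core.swap, ← h]
      convert h1 using 1
      group
  | succ i ih =>
    obtain ⟨gu, gv, ss, hc, hb, hg⟩ := ih
    rw [Function.iterate_succ_apply', Function.iterate_succ_apply']
    simp only [transRIter]
    generalize (𝒢.cR)^[i] u = u' at *
    generalize (𝒢.cR)^[i] v = v' at *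
    generalize 𝒢.transRIter v i s = s' at *
    have hinf : 𝒢.inf u' = 𝒢.inf v' := by rw [gu.2.1, gv.2.1]
    have gcv := 𝒢.good_cR hx gv
    unfold transR
    rw [hc]
    refine ⟨𝒢.good_cR hx gu, gcv, 𝒢.transport_simple ss hc hinf, ?_, ?_, ?_⟩
    · unfold cR
      rw [← hc]
      group
    · intro h0
      have h1 : 𝒢.iotaR v' * s'⁻¹ ∈ 𝒢.pos := hb h0
      have := 𝒢.transport_pos (v := u') (u := 𝒢.cR v') h1 (by
        rw [← hc]
        unfold cR
        group) (by rw [gcv.2.1, gu.2.1])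
      unfold RightDvd
      convert this using 1
      group
    · intro hr h0
      have hl := 𝒢.good_len gv
      have hl' : 𝒢.len v' = 𝒢.len x := by omega
      have h1 := hg hr h0
      have := 𝒢.grey_step (v := v') (u := u') (s := s') ss (by rw [hl']; exact hr)
        (by rw [hl', gv.2.1]; exact h1)
      rw [hl', gv.2.1] at this
      exact this

end GarsideGroup

end Garside

namespace Garside

/-- **Proposition 4.18 and its corollary.** Let `x ∈ Bₙ` be a left rigid braid
with `ℓ(x) = r > 1` and let `s` be an arrow from `x` to `y` in `USG_L(x)` with
`s ≼ ι_L(x)` (a black arrow, i.e. a partial left cycling). Then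
`Φ(s) = s^{(2rt)}_R` is an arrow from `Φ(y)` to `Φ(x)` in `USG_R(x)` with
`ι_R(Φ(y)) ≽ Φ(s)` (a black arrow, i.e. a partial right cycling).
Consequently, `Φ` sends black arrows to black arrows and grey arrows
(`s ≼ ι_L(u⁻¹)`) to grey arrows (`ι_R(Φ(v)⁻¹) ≽ Φ(s)`). -/
theorem Phi_preserves_colours {n : ℕ} (𝒢 : GarsideGroup (BraidGroup n))
    (h𝒢 : IsBraidGarside n 𝒢) (x : BraidGroup n) (r : ℕ)
    (hr : 𝒢.len x = r) (hr1 : 1 < r) (hx : 𝒢.LeftRigid x)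
    (y s : BraidGroup n) (hyU : y ∈ 𝒢.USSL x) (hs : Simple 𝒢.pos 𝒢.Δ s)
    (harr : s⁻¹ * x * s = y) (hblack : LeftDvd 𝒢.pos s (𝒢.iotaL x))
    (t : ℕ) (hrx : 𝒢.RightRigid ((𝒢.cR)^[2 * r * t] x))
    (hry : 𝒢.RightRigid ((𝒢.cR)^[2 * r * t] y)) :
    (RightDvd 𝒢.pos (𝒢.transRIter y (2 * r * t) s)
        (𝒢.iotaR ((𝒢.cR)^[2 * r * t] y)) ∧
      𝒢.transRIter y (2 * r * t) s * ((𝒢.cR)^[2 * r * t] y) *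
          (𝒢.transRIter y (2 * r * t) s)⁻¹ = (𝒢.cR)^[2 * r * t] x) ∧
    (∀ u v s' : BraidGroup n, u ∈ 𝒢.USSL x → v ∈ 𝒢.USSL x →
      Simple 𝒢.pos 𝒢.Δ s' → s'⁻¹ * u * s' = v →
      ∀ t' : ℕ, 𝒢.RightRigid ((𝒢.cR)^[2 * r * t'] u) →
        𝒢.RightRigid ((𝒢.cR)^[2 * r * t'] v) →
        (LeftDvd 𝒢.pos s' (𝒢.iotaL u) →
          RightDvd 𝒢.pos (𝒢.transRIter v (2 * r * t') s')
            (𝒢.iotaR ((𝒢.cR)^[2 * r * t'] v))) ∧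
        (LeftDvd 𝒢.pos s' (𝒢.iotaL u⁻¹) →
          RightDvd 𝒢.pos (𝒢.transRIter v (2 * r * t') s')
            (𝒢.iotaR (((𝒢.cR)^[2 * r * t'] v)⁻¹)))) := by
  subst hr
  have main : ∀ u v s' : BraidGroup n,
      𝒢.Good x (𝒢.inf x) (𝒢.inf x + 𝒢.len x) u → 𝒢.Good x (𝒢.inf x) (𝒢.inf x + 𝒢.len x) v →
      Simple 𝒢.pos 𝒢.Δ s' → s'⁻¹ * u * s' = v → ∀ i : ℕ,
      (LeftDvd 𝒢.pos s' (𝒢.iotaL u⁻¹) →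
          RightDvd 𝒢.pos (𝒢.transRIter v i s') (𝒢.iotaR (((𝒢.cR)^[i] v)⁻¹))) := by
    intro u v s' hu hv hs' h i h0
    obtain ⟨-, gv, ss, -, -, hg⟩ := 𝒢.iter_main hx hu hv hs' h i
    rw [𝒢.iotaR_spec]
    refine ⟨?_, 𝒢.simple_right ss⟩
    have := hg hr1 h0
    rw [gv.2.2, neg_neg]
    exact this
  constructor
  · obtain ⟨-, -, -, h1, h2, -⟩ :=
      𝒢.iter_main hx (𝒢.good_self hx) (𝒢.good_SSS hx hyU.1) hs harr (2 * 𝒢.len x * t)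
    exact ⟨h2 hblack, h1⟩
  · intro u v s' hu hv hs' h t' _ _
    have gu := 𝒢.good_SSS hx hu.1
    have gv := 𝒢.good_SSS hx hv.1
    exact ⟨(𝒢.iter_main hx gu gv hs' h (2 * 𝒢.len x * t')).2.2.2.2.1,
      main u v s' gu gv hs' h (2 * 𝒢.len x * t')⟩

end Garside
end
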